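/- arXiv:1109.2274 — 2 statements merged into one kernel-verified Lean document; each statement's English description precedes it below -/
import Mathlib

section
/- Let l ≥ 3 be an integer, set L = 2^(l−1) and σ_l = 1 − l/(2L − 2). Then for every Dirichlet character χ modulo a, uniformly for σ ≥ σ_l and |t| ≥ 2, one has L(σ + it, χ) ≪_a |t|^{1/(2L−2)} · log|t|. -/
/-- The unimodular number with phase `x`, measured in full turns. -/
noncomputable def unitPhase (x : ℝ) : ℂ := Complex.exp ((2 * Real.pi * x : ℝ) * Complex.I)

lemma norm_unitPhase (x : ℝ) : ‖unitPhase x‖ = 1 := Complex.norm_exp_ofReal_mul_I _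

lemma unitPhase_add (x y : ℝ) : unitPhase (x + y) = unitPhase x * unitPhase y := by
  rw [unitPhase, unitPhase, unitPhase, ← Complex.exp_add]
  push_cast
  ring_nf

lemma unitPhase_neg (x : ℝ) : unitPhase (-x) = (starRingEnd ℂ) (unitPhase x) := by
  rw [unitPhase, unitPhase, ← Complex.exp_conj, map_mul, Complex.conj_ofReal, Complex.conj_I]
  push_cast
  ring_nf

lemma unitPhase_intCast (m : ℤ) : unitPhase m = 1 := by
  rw [unitPhase, Complex.exp_eq_one_iff]
  exact ⟨m, by push_cast; ring⟩

lemma unitPhase_sub_intCast (x : ℝ) (m : ℤ) : unitPhase (x - m) = unitPhase x := by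
  have h : unitPhase (-(m : ℝ)) = 1 := by
    simpa using unitPhase_intCast (-m)
  rw [sub_eq_add_neg, unitPhase_add, h, mul_one]

lemma norm_sum_unitPhase_le (s : Finset ℕ) (f : ℕ → ℝ) :
    ‖∑ n ∈ s, unitPhase (f n)‖ ≤ s.card := by
  refine (norm_sum_le _ _).trans ?_
  simp [norm_unitPhase]

lemma norm_sum_unitPhase_neg (s : Finset ℕ) (f : ℕ → ℝ) :
    ‖∑ n ∈ s, unitPhase (-f n)‖ = ‖∑ n ∈ s, unitPhase (f n)‖ := by
  simp_rw [unitPhase_neg, ← map_sum]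
  exact RCLike.norm_conj _

/-! ### The Kusmin–Landau inequality -/

lemma half_one_add_cot_mul_one_sub_unitPhase {x : ℝ} (hx : Real.sin (Real.pi * x) ≠ 0) :
    (1 / 2 : ℂ) * (1 + (Real.cos (Real.pi * x) / Real.sin (Real.pi * x) : ℝ) * Complex.I) *
      (1 - unitPhase x) = 1 := by
  have h : unitPhase x = ((Real.cos (Real.pi * x) : ℂ) + Real.sin (Real.pi * x) * Complex.I) ^ 2 := by
    rw [unitPhase, Complex.ofReal_cos, Complex.ofReal_sin, ← Complex.exp_mul_I, ← Complex.exp_nat_mul]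
    push_cast
    ring_nf
  have hs : (Real.sin (Real.pi * x) : ℂ) ≠ 0 := by exact_mod_cast hx
  have hcs : (Real.cos (Real.pi * x) : ℂ) ^ 2 = 1 - (Real.sin (Real.pi * x) : ℂ) ^ 2 := by
    have := Real.cos_sq' (Real.pi * x)
    exact_mod_cast this
  rw [h]
  rw [Complex.ofReal_div]
  generalize (Real.cos (Real.pi * x) : ℂ) = c at *
  generalize (Real.sin (Real.pi * x) : ℂ) = s at *
  field_simp
  have hI := Complex.I_sq
  linear_combination (s - c * Complex.I) * hcs -
    (s ^ 3 + 2 * c ^ 2 * s + c * s ^ 2 * Complex.I) * hI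

lemma two_mul_le_sin_pi_mul {θ x : ℝ} (h1 : θ ≤ x) (h2 : x ≤ 1 - θ) (hθ : 0 ≤ θ) :
    2 * θ ≤ Real.sin (Real.pi * x) := by
  have hpi := Real.pi_pos
  rcases le_total x (1 / 2) with h | h
  · have := Real.mul_le_sin (x := Real.pi * x) (by nlinarith) (by nlinarith)
    have e : 2 / Real.pi * (Real.pi * x) = 2 * x := by field_simp
    linarith
  · have := Real.mul_le_sin (x := Real.pi * (1 - x)) (by nlinarith) (by nlinarith)
    have e : 2 / Real.pi * (Real.pi * (1 - x)) = 2 * (1 - x) := by field_simp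
    have e2 : Real.sin (Real.pi * (1 - x)) = Real.sin (Real.pi * x) := by
      rw [mul_sub, mul_one, Real.sin_pi_sub]
    linarith

lemma cot_antitone {x y : ℝ} (hx : 0 < x) (hxy : x ≤ y) (hy : y < Real.pi) :
    Real.cos y / Real.sin y ≤ Real.cos x / Real.sin x := by
  have h1 : 0 < Real.sin x := Real.sin_pos_of_pos_of_lt_pi hx (by linarith)
  have h2 : 0 < Real.sin y := Real.sin_pos_of_pos_of_lt_pi (by linarith) hy
  rw [div_le_div_iff₀ h2 h1]
  have := Real.sin_nonneg_of_nonneg_of_le_pi (x := y - x) (by linarith) (by linarith)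
  rw [Real.sin_sub] at this
  linarith

/-- The Kusmin–Landau inequality for a sequence of phases. -/
lemma norm_sum_unitPhase_le_of_monotone {f : ℕ → ℝ} {N : ℕ} {θ : ℝ} (hθ : 0 < θ)
    (hmono : ∀ n, n + 1 < N → f (n + 1) - f n ≤ f (n + 2) - f (n + 1))
    (hlow : ∀ n < N, θ ≤ f (n + 1) - f n) (hup : ∀ n < N, f (n + 1) - f n ≤ 1 - θ) :
    ‖∑ n ∈ Finset.range N, unitPhase (f n)‖ ≤ 1 / θ := by
  set d : ℕ → ℝ := fun n => f (n + 1) - f n with hd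
  set κ : ℕ → ℝ := fun n => Real.cos (Real.pi * d n) / Real.sin (Real.pi * d n) with hκ
  set c : ℕ → ℂ := fun n => (1 / 2 : ℂ) * (1 + (κ n : ℝ) * Complex.I) with hc
  have hsin : ∀ n < N, 2 * θ ≤ Real.sin (Real.pi * d n) := fun n hn =>
    two_mul_le_sin_pi_mul (hlow n hn) (hup n hn) hθ.le
  have hz : ∀ n < N, unitPhase (f n) + c n * unitPhase (f (n + 1)) = c n * unitPhase (f n) := by
    intro n hn
    have h1 := half_one_add_cot_mul_one_sub_unitPhase (x := d n) (by linarith [hsin n hn])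
    have h2 : unitPhase (f (n + 1)) = unitPhase (f n) * unitPhase (d n) := by
      rw [← unitPhase_add]; congr 1; simp [hd]
    rw [h2]
    have h3 : c n * (1 - unitPhase (d n)) = 1 := h1
    linear_combination (-unitPhase (f n)) * h3
  have hκm : ∀ n, n + 1 < N → κ (n + 1) ≤ κ n := by
    intro n hn
    have hpi := Real.pi_pos
    have h1 := hlow n (by omega)
    have h2 := hup (n + 1) hn
    refine cot_antitone (mul_pos hpi (hθ.trans_le h1)) ?_ ?_
    · exact mul_le_mul_of_nonneg_left (hmono n hn) hpi.le
    · have : d (n + 1) < 1 := by simp only [hd]; linarith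
      nlinarith
  have hκb : ∀ n < N, |κ n| ≤ 1 / (2 * θ) := by
    intro n hn
    have := hsin n hn
    rw [hκ, abs_div, abs_of_pos (by linarith : 0 < Real.sin (Real.pi * d n))]
    exact div_le_div₀ zero_le_one (Real.abs_cos_le_one _) (by positivity) this
  have hcb : ∀ n < N, ‖c n‖ ≤ 1 / (4 * θ) := by
    intro n hn
    have h0 := hsin n hn
    have hs : 0 < Real.sin (Real.pi * d n) := by linarith
    have h1 : ‖(1 + (κ n : ℝ) * Complex.I : ℂ)‖ = 1 / Real.sin (Real.pi * d n) := by
      have : (1 + (κ n : ℝ) * Complex.I : ℂ) = ((1 : ℝ) : ℂ) + (κ n : ℝ) * Complex.I := by simp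
      rw [this, Complex.norm_add_mul_I, Real.sqrt_eq_iff_mul_self_eq (add_nonneg (sq_nonneg _) (sq_nonneg _)) (one_div_pos.mpr hs).le]
      simp only [hκ]
      field_simp
      linarith [Real.sin_sq_add_cos_sq (Real.pi * d n)]
    rw [hc, norm_mul, h1]
    have : ‖(1 / 2 : ℂ)‖ = 1 / 2 := by norm_num
    rw [this, div_mul_div_comm, one_mul]
    exact one_div_le_one_div_of_le (by positivity) (by linarith)
  have key : ∀ m, m < N → ‖∑ n ∈ Finset.range (m + 1), unitPhase (f n) + c m * unitPhase (f (m + 1))‖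
      ≤ ‖c 0‖ + (κ 0 - κ m) / 2 := by
    intro m
    induction m with
    | zero => intro h; simp [hz 0 h, norm_unitPhase]
    | succ m ih =>
      intro h
      have e : ∑ n ∈ Finset.range (m + 1 + 1), unitPhase (f n) + c (m + 1) * unitPhase (f (m + 2))
          = (∑ n ∈ Finset.range (m + 1), unitPhase (f n) + c m * unitPhase (f (m + 1)))
            + (c (m + 1) - c m) * unitPhase (f (m + 1)) := by
        rw [Finset.sum_range_succ]
        linear_combination hz (m + 1) h
      have e2 : ‖(c (m + 1) - c m) * unitPhase (f (m + 1))‖ = (κ m - κ (m + 1)) / 2 := by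
        have : c (m + 1) - c m = (((κ (m + 1) - κ m) / 2 : ℝ) : ℂ) * Complex.I := by
          simp only [hc]; push_cast; ring
        rw [norm_mul, norm_unitPhase, this, norm_mul, Complex.norm_real, Complex.norm_I, mul_one,
          mul_one, Real.norm_eq_abs, abs_of_nonpos (by linarith [hκm m h])]
        ring
      rw [e]
      refine (norm_add_le _ _).trans ?_
      rw [e2]
      linarith [ih (by omega)]
  rcases Nat.eq_zero_or_pos N with h0 | h0
  · subst h0; simp; positivity
  obtain ⟨m, rfl⟩ : ∃ m, N = m + 1 := ⟨N - 1, by omega⟩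
  have h1 := key m (by omega)
  have h2 : ‖∑ n ∈ Finset.range (m + 1), unitPhase (f n)‖ ≤
      (‖c 0‖ + (κ 0 - κ m) / 2) + ‖c m‖ := by
    have := norm_sub_le (∑ n ∈ Finset.range (m + 1), unitPhase (f n) + c m * unitPhase (f (m + 1)))
      (c m * unitPhase (f (m + 1)))
    rw [add_sub_cancel_right, norm_mul (c m), norm_unitPhase, mul_one] at this
    linarith
  have h3 := hcb 0 (by omega)
  have h4 := hcb m (by omega)
  have h5 := (abs_le.mp (hκb 0 (by omega))).2
  have h6 := (abs_le.mp (hκb m (by omega))).1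
  have e1 : 1 / (4 * θ) = 1 / θ / 4 := by field_simp
  have e2 : 1 / (2 * θ) = 1 / θ / 2 := by field_simp
  linarith

/-! ### The second derivative test -/

lemma add_mul_le_of_step {d : ℕ → ℝ} {N : ℕ} {ρ : ℝ} (h : ∀ n, n + 1 < N → d n + ρ ≤ d (n + 1))
    (n k : ℕ) (hk : n + k < N) : d n + k * ρ ≤ d (n + k) := by
  induction k with
  | zero => simp
  | succ k ih =>
    have h1 := ih (by omega)
    have h2 := h (n + k) (by omega)
    rw [← add_assoc]
    push_cast
    linarith

lemma exists_threshold {d : ℕ → ℝ} {N : ℕ} (h : ∀ m n, m ≤ n → n < N → d m ≤ d n) (u : ℝ) :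
    ∃ p ≤ N, (∀ n < p, d n < u) ∧ ∀ n, p ≤ n → n < N → u ≤ d n := by
  classical
  have hex : ∃ n, n = N ∨ (n < N ∧ u ≤ d n) := ⟨N, Or.inl rfl⟩
  have hle : Nat.find hex ≤ N := Nat.find_min' hex (Or.inl rfl)
  refine ⟨Nat.find hex, hle, fun n hn => ?_, fun n hpn hn => ?_⟩
  · have := Nat.find_min hex hn
    push Not at this
    exact this.2 (by omega)
  · rcases Nat.find_spec hex with h1 | h1
    · omega
    · exact h1.2.trans (h _ _ hpn hn)

lemma norm_sum_unitPhase_le_of_gap {ρ μ : ℝ} (hρ : 0 < ρ) (hμ : 0 < μ) (hμ' : μ ≤ 1 / 2) (M : ℕ) :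
    ∀ (f : ℕ → ℝ) (N : ℕ),
      (∀ n, n + 1 < N → f (n + 1) - f n + ρ ≤ f (n + 2) - f (n + 1)) →
      (∀ n < N, -μ ≤ f (n + 1) - f n) → (∀ n < N, f (n + 1) - f n < M - μ) →
      ‖∑ n ∈ Finset.range N, unitPhase (f n)‖ ≤ M * (2 * μ / ρ + 1 + 1 / μ) := by
  induction M with
  | zero =>
    intro f N _ hlow hup
    rcases Nat.eq_zero_or_pos N with h0 | h0
    · simp [h0]
    · have h1 := hlow 0 h0
      have h2 := hup 0 h0
      push_cast at h2
      linarith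
  | succ M ih =>
    intro f N hstep hlow hup
    set d : ℕ → ℝ := fun n => f (n + 1) - f n with hd
    have hstep' : ∀ n, n + 1 < N → d n + ρ ≤ d (n + 1) := hstep
    have hmono : ∀ m n, m ≤ n → n < N → d m ≤ d n := by
      intro m n hmn hn
      obtain ⟨k, rfl⟩ := Nat.exists_eq_add_of_le hmn
      have := add_mul_le_of_step hstep' m k hn
      nlinarith [mul_nonneg (Nat.cast_nonneg (α := ℝ) k) hρ.le]
    obtain ⟨p, hpN, hp1, hp2⟩ := exists_threshold hmono μ
    obtain ⟨q, hqN, hq1, hq2⟩ := exists_threshold hmono (1 - μ)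
    have hpq : p ≤ q := by
      by_contra! hlt
      have h1 := hp1 q hlt
      have h2 := hq2 q le_rfl (by omega)
      linarith
    obtain ⟨r, rfl⟩ := Nat.exists_eq_add_of_le hpq
    obtain ⟨v, rfl⟩ := Nat.exists_eq_add_of_le hqN
    have hpb : (p : ℝ) ≤ 2 * μ / ρ + 1 := by
      rcases Nat.eq_zero_or_pos p with h0 | h0
      · rw [h0]; push_cast; positivity
      · obtain ⟨p', rfl⟩ : ∃ p', p = p' + 1 := ⟨p - 1, by omega⟩
        have h1 := add_mul_le_of_step hstep' 0 p' (by omega)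
        have h2 := hp1 p' (by omega)
        have h3 := hlow 0 (by omega)
        rw [zero_add] at h1
        have h4 : (p' : ℝ) * ρ ≤ 2 * μ := by
          have : -μ ≤ d 0 := h3
          linarith
        push_cast
        have := (le_div_iff₀ hρ).mpr h4
        linarith
    have s1 : ‖∑ n ∈ Finset.range p, unitPhase (f n)‖ ≤ 2 * μ / ρ + 1 :=
      (norm_sum_unitPhase_le _ _).trans (by simpa using hpb)
    have s2 : ‖∑ n ∈ Finset.range r, unitPhase (f (p + n))‖ ≤ 1 / μ := by
      refine norm_sum_unitPhase_le_of_monotone (f := fun n => f (p + n)) hμ ?_ ?_ ?_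
      · intro n hn
        have := hstep (p + n) (by omega)
        simp only [← add_assoc]
        linarith
      · intro n hn
        exact hp2 (p + n) (by omega) (by omega)
      · intro n hn
        exact (hq1 (p + n) (by omega)).le
    have s3 : ‖∑ n ∈ Finset.range v, unitPhase (f (p + r + n))‖ ≤ M * (2 * μ / ρ + 1 + 1 / μ) := by
      have e : ∀ n, unitPhase (f (p + r + n)) = unitPhase (f (p + r + n) - n) := fun n => by
        have := unitPhase_sub_intCast (f (p + r + n)) n
        rw [← this]; norm_cast
      simp_rw [e]
      refine ih (fun n => f (p + r + n) - n) v ?_ ?_ ?_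
      · intro n hn
        have := hstep (p + r + n) (by omega)
        simp only [← add_assoc]
        push_cast
        linarith
      · intro n hn
        have : 1 - μ ≤ f (p + r + n + 1) - f (p + r + n) := hq2 (p + r + n) (by omega) (by omega)
        simp only [← add_assoc]
        push_cast
        linarith
      · intro n hn
        have := hup (p + r + n) (by omega)
        simp only [← add_assoc]
        push_cast at this ⊢
        linarith
    rw [Finset.sum_range_add, Finset.sum_range_add]
    refine (norm_add₃_le).trans ?_
    push_cast
    linarith

lemma norm_sum_unitPhase_le_second {c C : ℝ} (hc : 0 < c) :
    ∃ A : ℝ, 0 ≤ A ∧ ∀ (f : ℕ → ℝ) (N : ℕ) (μ : ℝ), 0 < μ →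
      (∀ n < N, c * μ ^ 2 ≤ f (n + 2) - f (n + 1) - (f (n + 1) - f n) ∧
        f (n + 2) - f (n + 1) - (f (n + 1) - f n) ≤ C * μ ^ 2) →
      ‖∑ n ∈ Finset.range N, unitPhase (f n)‖ ≤ A * (N * μ + μ⁻¹) := by
  refine ⟨2 + (2 / c + 2) * (|C| + 2), by positivity, fun f N μ hμ h => ?_⟩
  rcases le_or_gt μ (1 / 2) with hμ' | hμ'
  swap
  · refine (norm_sum_unitPhase_le _ _).trans ?_
    rw [Finset.card_range]
    have h1 : (N : ℝ) ≤ 2 * (N * μ) := by nlinarith [Nat.cast_nonneg (α := ℝ) N]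
    have h2 : 0 ≤ (2 / c + 2) * (|C| + 2) := by positivity
    have h3 : 0 ≤ μ⁻¹ := by positivity
    have h4 : 0 ≤ N * μ := by positivity
    nlinarith [mul_nonneg h2 (add_nonneg h4 h3)]
  set D := |C| with hD
  have hD0 : 0 ≤ D := abs_nonneg C
  set m : ℤ := ⌊f 1 - f 0 + μ⌋ with hm
  set M : ℕ := ⌈D * μ ^ 2 * N⌉₊ + 1 with hM
  have hM1 : D * μ ^ 2 * N + 1 ≤ M := by
    rw [hM]; push_cast; linarith [Nat.le_ceil (D * μ ^ 2 * N)]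
  have hM2 : (M : ℝ) ≤ D * μ ^ 2 * N + 2 := by
    rw [hM]; push_cast; linarith [Nat.ceil_lt_add_one (a := D * μ ^ 2 * N) (by positivity)]
  have hm1 := Int.floor_le (f 1 - f 0 + μ)
  have hm2 := Int.lt_floor_add_one (f 1 - f 0 + μ)
  rw [← hm] at hm1 hm2
  have hup : ∀ n < N, f (n + 1) - f n ≤ f 1 - f 0 + n * (D * μ ^ 2) := by
    intro n
    induction n with
    | zero => intro _; simp
    | succ n ih =>
      intro hn
      have h1 := ih (by omega)
      have h2 := (h n (by omega)).2
      have h3 : C * μ ^ 2 ≤ D * μ ^ 2 := mul_le_mul_of_nonneg_right (le_abs_self C) (by positivity)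
      push_cast
      linarith
  have hlow : ∀ n < N, f 1 - f 0 ≤ f (n + 1) - f n := by
    intro n hn
    have := add_mul_le_of_step (d := fun n => f (n + 1) - f n) (N := N) (ρ := 0) (fun k hk => by
      have := (h k (by omega)).1
      have h0 : 0 ≤ c * μ ^ 2 := by positivity
      linarith) 0 n (by omega)
    simpa using this
  have e : ∀ n, unitPhase (f n) = unitPhase (f n - n * m) := fun n => by
    have := unitPhase_sub_intCast (f n) (n * m)
    rw [← this]; push_cast; rfl
  have main := norm_sum_unitPhase_le_of_gap (ρ := c * μ ^ 2) (by positivity) hμ hμ' M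
    (fun n => f n - n * m) N (fun n hn => by
      have := (h n (by omega)).1
      push_cast
      linarith) (fun n hn => by
      have := hlow n hn
      push_cast
      linarith) (fun n hn => by
      have h1 := hup n hn
      have h2 : (n : ℝ) * (D * μ ^ 2) ≤ D * μ ^ 2 * N := by
        rw [mul_comm]
        exact mul_le_mul_of_nonneg_left (by exact_mod_cast hn.le) (by positivity)
      push_cast
      linarith)
  simp_rw [e]
  refine main.trans ?_
  have hB : 2 * μ / (c * μ ^ 2) + 1 + 1 / μ ≤ (2 / c + 2) * μ⁻¹ := by
    have e1 : 2 * μ / (c * μ ^ 2) = 2 / c * μ⁻¹ := by field_simp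
    have e2 : 1 ≤ μ⁻¹ := (one_le_inv₀ hμ).mpr (by linarith)
    rw [e1, one_div]
    linarith
  have hB0 : 0 ≤ (2 / c + 2) * μ⁻¹ := by positivity
  calc (M : ℝ) * (2 * μ / (c * μ ^ 2) + 1 + 1 / μ) ≤ (D * μ ^ 2 * N + 2) * ((2 / c + 2) * μ⁻¹) := by
        gcongr
    _ = (2 / c + 2) * (D * (N * μ) + 2 * μ⁻¹) := by field_simp
    _ ≤ (2 / c + 2) * ((D + 2) * (N * μ + μ⁻¹)) := by
        have h3 : 0 ≤ μ⁻¹ := by positivity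
        have h4 : 0 ≤ N * μ := by positivity
        gcongr
        nlinarith [mul_nonneg hD0 h3]
    _ ≤ _ := by
        have h3 : 0 ≤ N * μ + μ⁻¹ := by positivity
        linarith

/-! ### Van der Corput's inequality and the higher derivative tests -/

open Finset in
lemma sum_range_dist_le {G : ℕ → ℝ} (hG : ∀ h, 0 ≤ G h) {H k : ℕ} (hk : k < H) :
    ∑ i ∈ range H, G (Nat.dist k i) ≤ 2 * ∑ h ∈ range H, G h := by
  obtain ⟨r, rfl⟩ := Nat.exists_eq_add_of_lt hk
  rw [show k + r + 1 = k + (r + 1) by ring, sum_range_add]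
  have h1 : ∑ i ∈ range k, G (Nat.dist k i) ≤ ∑ h ∈ range (k + (r + 1)), G h := by
    calc ∑ i ∈ range k, G (Nat.dist k i) = ∑ i ∈ range k, G (i + 1) := by
          rw [← sum_range_reflect (fun i => G (i + 1))]
          refine sum_congr rfl fun i hi => ?_
          have := mem_range.mp hi
          congr 1
          rw [Nat.dist_eq_sub_of_le_right this.le]
          omega
      _ ≤ ∑ i ∈ range (k + 1), G i := by
          rw [sum_range_succ']
          linarith [hG 0]
      _ ≤ _ := sum_le_sum_of_subset_of_nonneg (range_mono (by omega)) fun i _ _ => hG i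
  have h2 : ∑ i ∈ range (r + 1), G (Nat.dist k (k + i)) ≤ ∑ h ∈ range (k + (r + 1)), G h := by
    calc ∑ i ∈ range (r + 1), G (Nat.dist k (k + i)) = ∑ i ∈ range (r + 1), G i := by
          refine sum_congr rfl fun i _ => ?_
          rw [Nat.dist_eq_sub_of_le (by omega)]
          congr 1
          omega
      _ ≤ _ := sum_le_sum_of_subset_of_nonneg (range_mono (by omega)) fun i _ _ => hG i
  linarith

open Finset in
lemma sum_range_add_eq_of_support {w : ℕ → ℂ} {N H R k : ℕ} (hw : ∀ n, n < H ∨ N + H ≤ n → w n = 0)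
    (hk : k ≤ H) (hR : N + H ≤ R) :
    ∑ n ∈ range R, w (n + k) = ∑ n ∈ range N, w (n + H) := by
  have h1 : ∑ n ∈ range (R + k), w n = ∑ n ∈ range R, w (n + k) := by
    rw [add_comm R k, sum_range_add, sum_eq_zero fun i hi => hw i (Or.inl ?_), zero_add]
    · exact sum_congr rfl fun i _ => by rw [add_comm]
    · have := mem_range.mp hi; omega
  obtain ⟨v, hv⟩ := Nat.exists_eq_add_of_le (show H + N ≤ R + k by omega)
  rw [← h1, hv, sum_range_add, sum_range_add, sum_eq_zero fun i hi => hw i (Or.inl (mem_range.mp hi)),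
    sum_eq_zero (s := range v) fun i _ => hw _ (Or.inr (by omega)), zero_add, add_zero]
  exact sum_congr rfl fun i _ => by rw [add_comm]

open Finset in
/-- Van der Corput's inequality. -/
lemma vanDerCorput_inequality {z : ℕ → ℂ} {N H : ℕ} {G : ℕ → ℝ} (hG : ∀ h, 0 ≤ G h) (hH : 0 < H)
    (hz : ∀ h < H, ‖∑ m ∈ range (N - h), z (m + h) * (starRingEnd ℂ) (z m)‖ ≤ G h) :
    H * ‖∑ n ∈ range N, z n‖ ^ 2 ≤ 2 * (N + H) * ∑ h ∈ range H, G h := by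
  set w : ℕ → ℂ := fun n => if H ≤ n ∧ n < N + H then z (n - H) else 0 with hw
  have hw0 : ∀ n, n < H ∨ N + H ≤ n → w n = 0 := fun n hn => if_neg (by omega)
  have hwz : ∀ n < N, w (n + H) = z n := fun n hn => by
    simp only [hw]; rw [if_pos (by omega), Nat.add_sub_cancel]
  have hsum : ∀ k ≤ H, ∑ n ∈ range (N + H), w (n + k) = ∑ n ∈ range N, z n := fun k hk => by
    rw [sum_range_add_eq_of_support hw0 hk le_rfl]
    exact sum_congr rfl fun n hn => hwz n (mem_range.mp hn)
  have hcorr : ∀ k h, k + h < H → ‖∑ n ∈ range (N + H), w (n + (k + h)) * (starRingEnd ℂ) (w (n + k))‖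
      ≤ G h := by
    intro k h hkh
    have e := sum_range_add_eq_of_support (w := fun n => w (n + h) * (starRingEnd ℂ) (w n)) (N := N)
      (H := H) (R := N + H) (k := k) (fun n hn => by simp [hw0 n hn]) (by omega) le_rfl
    have e2 : ∑ n ∈ range N, w (n + H + h) * (starRingEnd ℂ) (w (n + H)) =
        ∑ m ∈ range (N - h), z (m + h) * (starRingEnd ℂ) (z m) := by
      rw [← sum_subset (range_mono (Nat.sub_le N h))]
      · refine sum_congr rfl fun n hn => ?_
        have := mem_range.mp hn
        rw [hwz n (by omega), add_right_comm, hwz (n + h) (by omega)]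
      · intro n hn hn'
        rw [mem_range] at hn hn'
        rw [hw0 (n + H + h) (Or.inr (by omega)), zero_mul]
    have e3 : ∑ n ∈ range (N + H), w (n + (k + h)) * (starRingEnd ℂ) (w (n + k)) =
        ∑ m ∈ range (N - h), z (m + h) * (starRingEnd ℂ) (z m) := by
      rw [← e2, ← e]
      exact sum_congr rfl fun n _ => by rw [add_assoc]
    rw [e3]
    exact hz h (by omega)
  have hcorr' : ∀ k < H, ∀ i < H,
      ‖∑ n ∈ range (N + H), w (n + k) * (starRingEnd ℂ) (w (n + i))‖ ≤ G (Nat.dist k i) := by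
    intro k hk i hi
    rcases le_total k i with hki | hki
    · obtain ⟨h, rfl⟩ := Nat.exists_eq_add_of_le hki
      have e : ∑ n ∈ range (N + H), w (n + k) * (starRingEnd ℂ) (w (n + (k + h))) = (starRingEnd ℂ)
          (∑ n ∈ range (N + H), w (n + (k + h)) * (starRingEnd ℂ) (w (n + k))) := by
        rw [map_sum]
        exact sum_congr rfl fun n _ => by rw [map_mul, Complex.conj_conj, mul_comm]
      rw [Nat.dist_eq_sub_of_le (by omega), Nat.add_sub_cancel_left, e, Complex.norm_conj]
      exact hcorr k h hi
    · obtain ⟨h, rfl⟩ := Nat.exists_eq_add_of_le hki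
      rw [Nat.dist_eq_sub_of_le_right (by omega), Nat.add_sub_cancel_left]
      exact hcorr i h hk
  have h1 : ((H : ℂ)) * ∑ n ∈ range N, z n = ∑ n ∈ range (N + H), ∑ k ∈ range H, w (n + k) := by
    rw [sum_comm, sum_congr rfl fun k hk => hsum k (mem_range.mp hk).le]
    simp
  have h2 : (H * ‖∑ n ∈ range N, z n‖) ^ 2 ≤
      (N + H) * ∑ n ∈ range (N + H), ‖∑ k ∈ range H, w (n + k)‖ ^ 2 := by
    have e : H * ‖∑ n ∈ range N, z n‖ = ‖∑ n ∈ range (N + H), ∑ k ∈ range H, w (n + k)‖ := by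
      rw [← h1, norm_mul, Complex.norm_natCast]
    rw [e]
    refine (pow_le_pow_left₀ (norm_nonneg _) (norm_sum_le _ _) 2).trans ?_
    refine sq_sum_le_card_mul_sum_sq.trans ?_
    rw [card_range]; push_cast; rfl
  have h3 : ∑ n ∈ range (N + H), ‖∑ k ∈ range H, w (n + k)‖ ^ 2 ≤
      ∑ k ∈ range H, ∑ i ∈ range H, G (Nat.dist k i) := by
    have e : ((∑ n ∈ range (N + H), ‖∑ k ∈ range H, w (n + k)‖ ^ 2 : ℝ) : ℂ) =
        ∑ k ∈ range H, ∑ i ∈ range H, ∑ n ∈ range (N + H), w (n + k) * (starRingEnd ℂ) (w (n + i)) := by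
      push_cast
      simp_rw [← Complex.mul_conj', map_sum, sum_mul_sum]
      rw [sum_comm]
      exact sum_congr rfl fun k _ => sum_comm
    have e2 : ∑ n ∈ range (N + H), ‖∑ k ∈ range H, w (n + k)‖ ^ 2 =
        ‖((∑ n ∈ range (N + H), ‖∑ k ∈ range H, w (n + k)‖ ^ 2 : ℝ) : ℂ)‖ := by
      rw [Complex.norm_real, Real.norm_of_nonneg (sum_nonneg fun _ _ => sq_nonneg _)]
    rw [e2, e]
    exact norm_sum_le_of_le _ fun k hk => norm_sum_le_of_le _ fun i hi =>
      hcorr' k (mem_range.mp hk) i (mem_range.mp hi)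
  have h4 : ∑ k ∈ range H, ∑ i ∈ range H, G (Nat.dist k i) ≤ H * (2 * ∑ h ∈ range H, G h) := by
    refine (sum_le_sum fun k hk => sum_range_dist_le hG (mem_range.mp hk)).trans ?_
    simp
  have hH' : (0 : ℝ) < H := by exact_mod_cast hH
  have h5 : (H * ‖∑ n ∈ range N, z n‖) ^ 2 ≤ (N + H) * (H * (2 * ∑ h ∈ range H, G h)) :=
    h2.trans (mul_le_mul_of_nonneg_left (h3.trans h4) (by positivity))
  refine le_of_mul_le_mul_left ?_ hH'
  linarith

lemma fwdDiff_iter_shift_sub (f : ℕ → ℝ) (k h n : ℕ) :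
    (fwdDiff 1)^[k] (fun m => f (m + h) - f m) n =
      ∑ i ∈ Finset.range h, (fwdDiff 1)^[k + 1] f (n + i) := by
  have e : (fun m => f (m + h) - f m) =
      ∑ i ∈ Finset.range h, fun m => fwdDiff 1 f (m + i) := by
    ext m
    rw [Finset.sum_apply]
    simp only [fwdDiff, add_assoc]
    exact (Finset.sum_range_sub (fun i => f (m + i)) h).symm
  rw [e, fwdDiff_iter_finsetSum, Finset.sum_apply]
  refine Finset.sum_congr rfl fun i _ => ?_
  rw [fwdDiff_iter_comp_add, Function.iterate_succ_apply]

lemma sum_range_inv_sqrt_le (H : ℕ) : ∑ h ∈ Finset.range H, (√h)⁻¹ ≤ 2 * √H := by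
  have key : ∀ H : ℕ, ∑ h ∈ Finset.range (H + 1), (√h)⁻¹ ≤ 2 * √H := by
    intro H
    induction H with
    | zero => simp
    | succ H ih =>
      rw [Finset.sum_range_succ]
      have h1 : 0 < √((H + 1 : ℕ) : ℝ) := Real.sqrt_pos.mpr (by positivity)
      have h2 : √((H + 1 : ℕ) : ℝ) ^ 2 = H + 1 := by
        rw [Real.sq_sqrt (by positivity)]; push_cast; rfl
      have h3 : √(H : ℝ) ^ 2 = H := Real.sq_sqrt (by positivity)
      have h4 : (√((H + 1 : ℕ) : ℝ))⁻¹ ≤ 2 * √((H + 1 : ℕ) : ℝ) - 2 * √(H : ℝ) := by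
        rw [inv_le_iff_one_le_mul₀ h1]
        nlinarith [sq_nonneg (√((H + 1 : ℕ) : ℝ) - √(H : ℝ))]
      linarith
  refine le_trans ?_ (key H)
  rw [Finset.sum_range_succ]
  have : 0 ≤ (√(H : ℝ))⁻¹ := by positivity
  linarith

/-- One differencing step of van der Corput's method: a bound for all the differenced sums
gives a bound for the original sum. -/
lemma norm_sum_unitPhase_le_of_differenced {A μ : ℝ} {f : ℕ → ℝ} {N p : ℕ} (hA : 0 ≤ A) (hμ : 0 < μ)
    (hp : 1 ≤ p)
    (h : ∀ h : ℕ, 0 < h → h * μ ^ 2 ≤ 1 →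
      ‖∑ n ∈ Finset.range (N - h), unitPhase (f (n + h) - f n)‖ ≤
        A * (N * μ ^ 2 + (√h)⁻¹ * (μ ^ (2 * p + 1))⁻¹)) :
    ‖∑ n ∈ Finset.range N, unitPhase (f n)‖ ≤ (8 + 8 * A) * (N * μ + (μ ^ (2 * p + 1))⁻¹) := by
  have htriv : ‖∑ n ∈ Finset.range N, unitPhase (f n)‖ ≤ N :=
    (norm_sum_unitPhase_le _ _).trans (by simp)
  set T := (μ ^ (2 * p + 1))⁻¹ with hT
  have hT0 : 0 < T := by positivity
  set x := N * μ with hx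
  have hx0 : 0 ≤ x := by positivity
  set S := ‖∑ n ∈ Finset.range N, unitPhase (f n)‖ with hS
  have hS0 : 0 ≤ S := norm_nonneg _
  have hbig : x + T ≤ (8 + 8 * A) * (x + T) := by nlinarith [mul_nonneg hA (add_nonneg hx0 hT0.le)]
  rcases le_or_gt 1 μ with hμ1 | hμ1
  · have : (N : ℝ) ≤ x := le_mul_of_one_le_right (by positivity) hμ1
    linarith
  set H := ⌊(μ ^ 2)⁻¹⌋₊ with hH
  have hinv : 1 ≤ (μ ^ 2)⁻¹ := (one_le_inv₀ (by positivity)).mpr (pow_le_one₀ hμ.le hμ1.le)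
  have hH1 : 1 ≤ H := Nat.le_floor (by simpa using hinv)
  have hHle : (H : ℝ) ≤ (μ ^ 2)⁻¹ := Nat.floor_le (by positivity)
  have hHlt : (μ ^ 2)⁻¹ < H + 1 := Nat.lt_floor_add_one _
  have hHR : (1 : ℝ) ≤ H := by exact_mod_cast hH1
  have hHμ : H * μ ^ 2 ≤ 1 := by
    have := mul_le_mul_of_nonneg_right hHle (sq_nonneg μ)
    rwa [inv_mul_cancel₀ (by positivity)] at this
  have hHμ' : 1 ≤ 2 * (H * μ ^ 2) := by
    have := mul_le_mul_of_nonneg_right (hHlt.le.trans (by linarith : (H : ℝ) + 1 ≤ 2 * H)) (sq_nonneg μ)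
    rw [inv_mul_cancel₀ (by positivity)] at this
    linarith
  rcases lt_or_ge N H with hNH | hNH
  · have h1 : (N : ℝ) ≤ (μ ^ 2)⁻¹ := le_trans (by exact_mod_cast hNH.le) hHle
    have h2 : (μ ^ 2)⁻¹ ≤ T := by
      apply inv_anti₀ (by positivity)
      exact pow_le_pow_of_le_one hμ.le hμ1.le (by omega)
    linarith
  set G : ℕ → ℝ := fun h => (if h = 0 then (N : ℝ) else 0) + A * (N * μ ^ 2 + (√h)⁻¹ * T) with hG
  have hG0 : ∀ h, 0 ≤ G h := fun h => by
    simp only [hG]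
    split_ifs <;> positivity
  have hvdc := vanDerCorput_inequality (z := fun n => unitPhase (f n)) (N := N) (H := H) hG0 hH1 (by
    intro h' hh'
    have e : ∀ m, unitPhase (f (m + h')) * (starRingEnd ℂ) (unitPhase (f m)) =
        unitPhase (f (m + h') - f m) := fun m => by
      rw [← unitPhase_neg, ← unitPhase_add, sub_eq_add_neg]
    simp_rw [e]
    simp only [hG]
    rcases Nat.eq_zero_or_pos h' with h0 | h0
    · rw [if_pos h0]
      refine (norm_sum_unitPhase_le _ _).trans ?_
      rw [Finset.card_range, h0, Nat.sub_zero]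
      have : 0 ≤ A * (N * μ ^ 2 + (√(0 : ℕ))⁻¹ * T) := by positivity
      linarith
    · rw [if_neg h0.ne', zero_add]
      refine h h' h0 (le_trans ?_ hHμ)
      have : (h' : ℝ) ≤ H := by exact_mod_cast hh'.le
      gcongr)
  rw [← hS] at hvdc
  have hsumG : ∑ h ∈ Finset.range H, G h ≤ N + A * (H * (N * μ ^ 2) + 2 * √H * T) := by
    simp only [hG]
    rw [Finset.sum_add_distrib, ← Finset.mul_sum, Finset.sum_add_distrib, ← Finset.sum_mul (Finset.range H) (fun h : ℕ => (√h)⁻¹)]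
    have h1 : ∑ h ∈ Finset.range H, (if h = 0 then (N : ℝ) else 0) = N := by
      rw [Finset.sum_ite_eq' (Finset.range H) 0]
      simp
      omega
    rw [h1, Finset.sum_const, Finset.card_range, nsmul_eq_mul]
    gcongr
    exact sum_range_inv_sqrt_le H
  set r := √(H : ℝ) with hr
  have hr2 : r ^ 2 = H := Real.sq_sqrt (by positivity)
  have hr0 : 0 < r := Real.sqrt_pos.mpr (by linarith)
  have hNH' : (H : ℝ) ≤ N := by exact_mod_cast hNH
  have h1 : H * S ^ 2 ≤ 4 * N * (N + A * (H * (N * μ ^ 2) + 2 * r * T)) := by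
    refine hvdc.trans ?_
    have hb : 0 ≤ N + A * (H * (N * μ ^ 2) + 2 * r * T) := by positivity
    calc _ ≤ 2 * ((N : ℝ) + H) * (N + A * (H * (N * μ ^ 2) + 2 * r * T)) := by gcongr
      _ ≤ _ := by nlinarith
  have hrμ : 1 ≤ 2 * (r * μ) := by
    have : 1 ≤ 2 * (r * μ) ^ 2 := by rw [mul_pow, hr2]; exact hHμ'
    have h0 : 0 ≤ r * μ := by positivity
    nlinarith
  have h2 : S ^ 2 ≤ 8 * x ^ 2 + 4 * A * x ^ 2 + 16 * A * x * T := by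
    have hHpos : (0 : ℝ) < H := by linarith
    refine le_of_mul_le_mul_left (h1.trans ?_) hHpos
    have a1 : (N : ℝ) ^ 2 ≤ 2 * H * x ^ 2 := by
      have : 2 * H * x ^ 2 = N ^ 2 * (2 * (H * μ ^ 2)) := by rw [hx]; ring
      rw [this]
      exact le_mul_of_one_le_right (by positivity) hHμ'
    have a2 : N * r * T * A ≤ 2 * H * x * T * A := by
      have : 2 * H * x * T * A = N * r * T * A * (2 * (r * μ)) := by rw [hx, ← hr2]; ring
      rw [this]
      exact le_mul_of_one_le_right (by positivity) hrμ
    have a3 : N * (A * (H * (N * μ ^ 2))) = A * H * x ^ 2 := by rw [hx]; ring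
    linarith
  refine le_of_sq_le_sq ?_ (by positivity)
  refine h2.trans ?_
  have b1 : 0 ≤ x * T := by positivity
  have b2 : (8 + 8 * A) * (x + T) ^ 2 ≤ ((8 + 8 * A) * (x + T)) ^ 2 := by
    rw [mul_pow]
    refine mul_le_mul_of_nonneg_right ?_ (sq_nonneg _)
    nlinarith
  refine le_trans ?_ b2
  nlinarith [mul_nonneg hA b1, mul_nonneg hA (sq_nonneg x), mul_nonneg hA (sq_nonneg T), sq_nonneg T]

/-- The discrete `(j + 2)`-th derivative test. -/
lemma norm_sum_unitPhase_le_of_fwdDiff {c C : ℝ} (hc : 0 < c) (j : ℕ) :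
    ∃ A : ℝ, 0 ≤ A ∧ ∀ (f : ℕ → ℝ) (N : ℕ) (μ : ℝ), 0 < μ →
      (∀ n < N, c * μ ^ (2 * (2 ^ (j + 1) - 1)) ≤ (fwdDiff 1)^[j + 2] f n ∧
        (fwdDiff 1)^[j + 2] f n ≤ C * μ ^ (2 * (2 ^ (j + 1) - 1))) →
      ‖∑ n ∈ Finset.range N, unitPhase (f n)‖ ≤ A * (N * μ + (μ ^ (2 ^ (j + 1) - 1))⁻¹) := by
  induction j with
  | zero =>
    obtain ⟨A, hA, h⟩ := norm_sum_unitPhase_le_second (C := C) hc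
    refine ⟨A, hA, fun f N μ hμ hf => ?_⟩
    simpa using h f N μ hμ fun n hn => by simpa [fwdDiff] using hf n hn
  | succ j ih =>
    obtain ⟨A, hA, ih⟩ := ih
    refine ⟨8 + 8 * A, by positivity, fun f N μ hμ hf => ?_⟩
    have hp1 : 1 ≤ 2 ^ (j + 1) - 1 := by
      have : 2 ≤ 2 ^ (j + 1) := by rw [pow_succ]; have := Nat.one_le_two_pow (n := j); omega
      omega
    have hpe : 2 ^ (j + 1 + 1) - 1 = 2 * (2 ^ (j + 1) - 1) + 1 := by
      rw [pow_succ 2 (j + 1)]; omega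
    rw [hpe] at hf ⊢
    generalize 2 ^ (j + 1) - 1 = p at *
    refine norm_sum_unitPhase_le_of_differenced hA hμ hp1 fun h h0 hhμ => ?_
    have h0' : (0 : ℝ) < h := by exact_mod_cast h0
    have hs0 : 0 < √(h : ℝ) := Real.sqrt_pos.mpr h0'
    have hs2 : √(h : ℝ) ^ 2 = h := Real.sq_sqrt h0'.le
    set ν : ℝ := (√h * μ ^ (2 * p + 1)) ^ ((p : ℝ)⁻¹) with hν
    have hν0 : 0 < ν := by positivity
    have hνp : ν ^ p = √h * μ ^ (2 * p + 1) :=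
      Real.rpow_inv_natCast_pow (by positivity) (by omega)
    have hν2p : ν ^ (2 * p) = h * μ ^ (2 * (2 * p + 1)) := by
      rw [pow_mul', hνp, mul_pow, hs2, ← pow_mul']
    have hνle : ν ≤ μ ^ 2 := by
      refine le_of_pow_le_pow_left₀ (n := p) (by omega) (by positivity) ?_
      rw [hνp, ← pow_mul, pow_succ]
      have : √h * μ ≤ 1 := by
        refine le_of_sq_le_sq ?_ zero_le_one
        rw [mul_pow, hs2, one_pow]; exact hhμ
      calc √h * (μ ^ (2 * p) * μ) = μ ^ (2 * p) * (√h * μ) := by ring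
        _ ≤ μ ^ (2 * p) := mul_le_of_le_one_right (by positivity) this
    refine (ih (fun n => f (n + h) - f n) (N - h) ν hν0 fun n hn => ?_).trans ?_
    · rw [fwdDiff_iter_shift_sub, hν2p]
      constructor
      · calc c * (h * μ ^ (2 * (2 * p + 1))) = ∑ i ∈ Finset.range h, c * μ ^ (2 * (2 * p + 1)) := by
              rw [Finset.sum_const, Finset.card_range, nsmul_eq_mul]; ring
          _ ≤ _ := Finset.sum_le_sum fun i hi => (hf (n + i) (by
              have := Finset.mem_range.mp hi; omega)).1
      · calc _ ≤ ∑ i ∈ Finset.range h, C * μ ^ (2 * (2 * p + 1)) :=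
              Finset.sum_le_sum fun i hi => (hf (n + i) (by
              have := Finset.mem_range.mp hi; omega)).2
          _ = _ := by
              rw [Finset.sum_const, Finset.card_range, nsmul_eq_mul]; ring
    · rw [hνp, mul_inv]
      have : ((N - h : ℕ) : ℝ) ≤ N := by exact_mod_cast Nat.sub_le N h
      gcongr

/-! ### Exponential sums with logarithmic phase -/

lemma exists_fwdDiff_iter_eq {x : ℝ} (hx : 0 < x) (k : ℕ) :
    ∀ F : ℕ → ℝ → ℝ, (∀ j, ∀ y, 0 < y → HasDerivAt (F j) (F (j + 1) y) y) → ∀ n : ℕ,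
      ∃ ξ ∈ Set.Icc (x + n) (x + n + k),
        (fwdDiff 1)^[k] (fun m : ℕ => F 0 (x + m)) n = F k ξ := by
  induction k with
  | zero => intro F _ n; exact ⟨x + n, by simp, rfl⟩
  | succ k ih =>
    intro F hF n
    have hF' : ∀ j, ∀ y, 0 < y →
        HasDerivAt (fun y => F j (y + 1) - F j y) (F (j + 1) (y + 1) - F (j + 1) y) y := by
      intro j y hy
      exact ((hF j (y + 1) (by linarith)).comp_add_const y 1).sub (hF j y hy)
    obtain ⟨ξ, hξ, h⟩ := ih (fun j y => F j (y + 1) - F j y) hF' n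
    have hξ0 : 0 < ξ := lt_of_lt_of_le (by positivity) hξ.1
    obtain ⟨ζ, hζ, h'⟩ := exists_hasDerivAt_eq_slope (F k) (F (k + 1)) (a := ξ) (b := ξ + 1)
      (by linarith)
      (fun y hy => (hF k y (by linarith [hy.1])).continuousAt.continuousWithinAt)
      (fun y hy => hF k y (by linarith [hy.1]))
    refine ⟨ζ, ⟨by linarith [hξ.1, hζ.1], by push_cast; linarith [hξ.2, hζ.2]⟩, ?_⟩
    rw [h', Function.iterate_succ_apply, add_sub_cancel_left, div_one, ← h]
    refine congrArg (fun g : ℕ → ℝ => (fwdDiff 1)^[k] g n) (funext fun m => ?_)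
    simp only [fwdDiff]
    push_cast
    rw [add_assoc]

lemma exists_fwdDiff_iter_log_eq {x : ℝ} (hx : 0 < x) (k n : ℕ) :
    ∃ ξ ∈ Set.Icc (x + n) (x + n + (k + 1 : ℕ)),
      (fwdDiff 1)^[k + 1] (fun m : ℕ => Real.log (x + m)) n =
        (-1) ^ k * k.factorial / ξ ^ (k + 1) := by
  refine exists_fwdDiff_iter_eq hx (k + 1) (fun j y => match j with
    | 0 => Real.log y
    | j + 1 => (-1) ^ j * j.factorial / y ^ (j + 1)) (fun j y hy => ?_) n
  match j with
  | 0 => simpa using Real.hasDerivAt_log hy.ne'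
  | j + 1 =>
    have h1 := ((hasDerivAt_pow (j + 1) y).inv (by positivity)).const_mul
      ((-1 : ℝ) ^ j * j.factorial)
    refine (h1.congr_deriv ?_)
    simp only [Nat.factorial_succ, Nat.add_sub_cancel]
    push_cast
    field_simp
    ring

lemma norm_sum_unitPhase_log_le (j : ℕ) :
    ∃ A : ℝ, 0 ≤ A ∧ ∀ (τ X x μ : ℝ) (M : ℕ), 0 < τ → 1 ≤ X → X ≤ x → x ≤ X + 1 → (M : ℝ) ≤ X →
      0 < μ → μ ^ (2 * (2 ^ (j + 1) - 1)) * X ^ (j + 2) = τ →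
      ‖∑ m ∈ Finset.range M, unitPhase (τ / (2 * Real.pi) * Real.log (x + m))‖ ≤
        A * (X * μ + (μ ^ (2 ^ (j + 1) - 1))⁻¹) := by
  have hpi := Real.pi_pos
  obtain ⟨A, hA, h⟩ := norm_sum_unitPhase_le_of_fwdDiff
    (c := (j + 1).factorial / (2 * Real.pi * (j + 5) ^ (j + 2)))
    (C := (j + 1).factorial / (2 * Real.pi)) (by positivity) j
  refine ⟨A, hA, fun τ X x μ M hτ hX hXx hxX hM hμ hμτ => ?_⟩
  have hx : 0 < x := by linarith
  have hsign : ‖∑ m ∈ Finset.range M, unitPhase (τ / (2 * Real.pi) * Real.log (x + m))‖ =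
      ‖∑ m ∈ Finset.range M,
        unitPhase (((-1) ^ (j + 1) * (τ / (2 * Real.pi))) * Real.log (x + m))‖ := by
    rcases neg_one_pow_eq_or ℝ (j + 1) with e | e
    · rw [e, one_mul]
    · rw [e, ← norm_sum_unitPhase_neg]
      simp only [neg_mul, one_mul]
  rw [hsign]
  refine (h (fun m => ((-1) ^ (j + 1) * (τ / (2 * Real.pi))) * Real.log (x + m)) M μ hμ
    fun n hn => ?_).trans (by gcongr)
  obtain ⟨ξ, hξ, e⟩ := exists_fwdDiff_iter_log_eq hx (j + 1) n
  have hnM : (n : ℝ) ≤ X := le_trans (by exact_mod_cast hn.le) hM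
  have hξX : X ≤ ξ := by linarith [hξ.1, Nat.cast_nonneg (α := ℝ) n]
  have hξX' : ξ ≤ (j + 5) * X := by
    have h1 := hξ.2
    push_cast at h1
    nlinarith [Nat.cast_nonneg (α := ℝ) j]
  have hξ0 : 0 < ξ := by linarith
  have e2 : (fwdDiff 1)^[j + 2]
      (fun m : ℕ => ((-1) ^ (j + 1) * (τ / (2 * Real.pi))) * Real.log (x + m)) n =
      (j + 1).factorial / (2 * Real.pi) * (τ / ξ ^ (j + 2)) := by
    have e3 := congrFun (fwdDiff_iter_const_smul (1 : ℕ) ((-1) ^ (j + 1) * (τ / (2 * Real.pi)))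
      (fun m : ℕ => Real.log (x + m)) (j + 2)) n
    refine Eq.trans e3 ?_
    rw [Pi.smul_apply, e, smul_eq_mul]
    have : ((-1 : ℝ) ^ (j + 1)) * (-1) ^ (j + 1) = 1 := by
      rw [← mul_pow]; norm_num
    calc _ = ((-1 : ℝ) ^ (j + 1) * (-1) ^ (j + 1)) *
          ((j + 1).factorial / (2 * Real.pi) * (τ / ξ ^ (j + 2))) := by ring
      _ = _ := by rw [this, one_mul]
  have hμ' : μ ^ (2 * (2 ^ (j + 1) - 1)) = τ / X ^ (j + 2) := by
    rw [eq_div_iff (by positivity), hμτ]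
  rw [e2, hμ']
  constructor
  · calc _ = (j + 1).factorial / (2 * Real.pi) * (τ / ((j + 5) * X) ^ (j + 2)) := by
          rw [mul_pow]; field_simp
      _ ≤ _ := by gcongr
  · gcongr

lemma norm_sum_unitPhase_log_le_of_le (j : ℕ) :
    ∃ A : ℝ, 0 ≤ A ∧ ∀ (τ X x μ : ℝ) (M : ℕ), 1 ≤ X → X ≤ τ → X ≤ x → x ≤ X + 1 → (M : ℝ) ≤ X →
      0 < μ → μ ^ (2 * (2 ^ (j + 1) - 1)) * X ^ (j + 2) = τ →
      ‖∑ m ∈ Finset.range M, unitPhase (τ / (2 * Real.pi) * Real.log (x + m))‖ ≤ A * (X * μ) := by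
  induction j with
  | zero =>
    obtain ⟨A, hA, h⟩ := norm_sum_unitPhase_log_le 0
    refine ⟨2 * A, by positivity, fun τ X x μ M hX hXτ hXx hxX hM hμ hμτ => ?_⟩
    refine (h τ X x μ M (by linarith) hX hXx hxX hM hμ hμτ).trans ?_
    have h2 : (μ ^ (2 ^ (0 + 1) - 1))⁻¹ ≤ X * μ := by
      norm_num at hμτ ⊢
      rw [inv_le_iff_one_le_mul₀ hμ]
      refine le_of_mul_le_mul_left (a := X) ?_ (by linarith)
      linarith
    linarith [mul_le_mul_of_nonneg_left h2 hA]
  | succ j ih =>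
    obtain ⟨A, hA, ih⟩ := ih
    obtain ⟨A', hA', h⟩ := norm_sum_unitPhase_log_le (j + 1)
    refine ⟨A + 2 * A', by positivity, fun τ X x μ M hX hXτ hXx hxX hM hμ hμτ => ?_⟩
    have hp1 : 1 ≤ 2 ^ (j + 1) - 1 := by
      have : 2 ≤ 2 ^ (j + 1) := by rw [pow_succ]; have := Nat.one_le_two_pow (n := j); omega
      omega
    have hpe : 2 ^ (j + 1 + 1) - 1 = 2 * (2 ^ (j + 1) - 1) + 1 := by
      rw [pow_succ 2 (j + 1)]; omega
    have h := h τ X x μ M (by linarith) hX hXx hxX hM hμ hμτ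
    rw [hpe] at h hμτ
    generalize 2 ^ (j + 1) - 1 = p at *
    have hX0 : 0 < X := by linarith
    have hXμ : 0 ≤ X * μ := by positivity
    rcases le_or_gt 1 (X * μ ^ (2 * p + 2)) with hc | hc
    · have h2 : (μ ^ (2 * p + 1))⁻¹ ≤ X * μ := by
        rw [inv_le_iff_one_le_mul₀ (by positivity)]
        calc 1 ≤ X * μ ^ (2 * p + 2) := hc
          _ = _ := by ring
      nlinarith [mul_le_mul_of_nonneg_left h2 hA', mul_nonneg hA hXμ]
    · set ν : ℝ := (τ / X ^ (j + 2)) ^ (((2 * p : ℕ) : ℝ)⁻¹) with hν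
      have hτ0 : 0 < τ := by linarith
      have hν0 : 0 < ν := by positivity
      have hνp : ν ^ (2 * p) = τ / X ^ (j + 2) :=
        Real.rpow_inv_natCast_pow (by positivity) (by omega)
      have hνμ : ν ≤ μ := by
        refine le_of_pow_le_pow_left₀ (n := 2 * p) (by omega) hμ.le ?_
        rw [hνp, ← hμτ]
        calc μ ^ (2 * (2 * p + 1)) * X ^ (j + 1 + 2) / X ^ (j + 2)
            = (X * μ ^ (2 * p + 2)) * μ ^ (2 * p) := by field_simp; ring
          _ ≤ μ ^ (2 * p) := mul_le_of_le_one_left (by positivity) hc.le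
      refine (ih τ X x ν M hX hXτ hXx hxX hM hν0 ?_).trans ?_
      · rw [hνp]; field_simp
      · have : X * ν ≤ X * μ := by gcongr
        nlinarith [mul_le_mul_of_nonneg_left this hA, mul_nonneg hA' hXμ]

lemma norm_sum_unitPhase_log_le_of_ge {τ X x : ℝ} {M : ℕ} (hτ : 0 < τ) (hX : 1 ≤ X) (hτX : τ ≤ X)
    (hXx : X ≤ x) (hxX : x ≤ X + 1) (hM : (M : ℝ) ≤ X) :
    ‖∑ m ∈ Finset.range M, unitPhase (τ / (2 * Real.pi) * Real.log (x + m))‖ ≤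
      8 * Real.pi * (X / τ) := by
  have hpi := Real.pi_pos
  have hpi3 := Real.pi_gt_three
  have hx0 : 0 < x := by linarith
  have hlog1 : ∀ y : ℝ, 0 < y → Real.log (y + 1) - Real.log y ≤ 1 / y := fun y hy => by
    rw [← Real.log_div (by positivity) (by positivity)]
    refine (Real.log_le_sub_one_of_pos (by positivity)).trans (le_of_eq ?_)
    field_simp; ring
  have hlog2 : ∀ y : ℝ, 0 < y → 1 / (y + 1) ≤ Real.log (y + 1) - Real.log y := fun y hy => by
    have := Real.log_le_sub_one_of_pos (x := y / (y + 1)) (by positivity)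
    rw [Real.log_div (by positivity) (by positivity)] at this
    have e : y / (y + 1) - 1 = - (1 / (y + 1)) := by field_simp; ring
    linarith
  have hlog3 : ∀ y : ℝ, 0 < y → Real.log (y + 1 + 1) - Real.log (y + 1) ≤
      Real.log (y + 1) - Real.log y := fun y hy => by
    rw [← Real.log_div (by positivity) (by positivity), ← Real.log_div (by positivity) (by positivity)]
    refine Real.log_le_log (by positivity) ?_
    rw [div_le_div_iff₀ (by positivity) (by positivity)]
    nlinarith
  have hτ' : 0 < τ / (2 * Real.pi) := by positivity
  rw [← norm_sum_unitPhase_neg]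
  have e : ∀ m : ℕ, unitPhase (-(τ / (2 * Real.pi) * Real.log (x + m))) =
      unitPhase (m - τ / (2 * Real.pi) * Real.log (x + m)) := fun m => by
    have := unitPhase_sub_intCast (m - τ / (2 * Real.pi) * Real.log (x + m)) m
    rw [← this]
    push_cast
    ring_nf
  simp_rw [e]
  have hθ : 0 < τ / (8 * Real.pi * X) := by positivity
  refine (norm_sum_unitPhase_le_of_monotone
    (f := fun m => m - τ / (2 * Real.pi) * Real.log (x + m)) hθ ?_ ?_ ?_).trans (le_of_eq ?_)
  · intro n hn
    have := mul_le_mul_of_nonneg_left (hlog3 (x + n) (by positivity)) hτ'.le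
    push_cast
    rw [show x + ((n : ℝ) + 2) = x + n + 1 + 1 by ring, ← add_assoc x]
    linarith
  · intro n hn
    have h1 := mul_le_mul_of_nonneg_left (hlog1 (x + n) (by positivity)) hτ'.le
    have h2 : τ / (2 * Real.pi) * (1 / (x + n)) ≤ 1 / 2 := by
      calc τ / (2 * Real.pi) * (1 / (x + n)) ≤ X / (2 * 1) * (1 / (X + 0)) := by
            gcongr
            · linarith
            · exact Nat.cast_nonneg n
        _ = 1 / 2 := by field_simp; simp
    have h3 : τ / (8 * Real.pi * X) ≤ 1 / 8 := by
      calc τ / (8 * Real.pi * X) ≤ X / (8 * 1 * X) := by gcongr; linarith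
        _ = 1 / 8 := by field_simp
    push_cast
    rw [← add_assoc x]
    linarith
  · intro n hn
    have hn' : (n : ℝ) + 1 ≤ X := le_trans (by exact_mod_cast hn) hM
    have h1 := mul_le_mul_of_nonneg_left (hlog2 (x + n) (by positivity)) hτ'.le
    have h2 : τ / (8 * Real.pi * X) ≤ τ / (2 * Real.pi) * (1 / (x + n + 1)) := by
      calc τ / (8 * Real.pi * X) = τ / (2 * Real.pi) * (1 / (4 * X)) := by field_simp; norm_num
        _ ≤ _ := by
          gcongr
          linarith
    push_cast
    rw [← add_assoc x]
    linarith
  · field_simp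

/-! ### Sums of `(n + α) ^ (-s)` -/

open Finset in
/-- Abel's inequality. -/
lemma norm_sum_antitone_mul_le {w : ℕ → ℝ} {z : ℕ → ℂ} {N : ℕ} {B : ℝ} (hw0 : ∀ n, 0 ≤ w n)
    (hw : Antitone w) (hB : 0 ≤ B) (h : ∀ M ≤ N, ‖∑ n ∈ range M, z n‖ ≤ B) :
    ‖∑ n ∈ range N, w n * z n‖ ≤ w 0 * B := by
  have key : ∀ m < N, ‖∑ n ∈ range (m + 1), w n * z n - w m * ∑ n ∈ range (m + 1), z n‖ ≤
      (w 0 - w m) * B := by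
    intro m
    induction m with
    | zero => simp
    | succ m ih =>
      intro hm
      have e : ∑ n ∈ range (m + 1 + 1), w n * z n - w (m + 1) * ∑ n ∈ range (m + 1 + 1), z n =
          (∑ n ∈ range (m + 1), w n * z n - w m * ∑ n ∈ range (m + 1), z n) +
            ((w m - w (m + 1) : ℝ) : ℂ) * ∑ n ∈ range (m + 1), z n := by
        rw [sum_range_succ _ (m + 1), sum_range_succ _ (m + 1)]
        push_cast
        ring
      have hd : 0 ≤ w m - w (m + 1) := sub_nonneg.mpr (hw (Nat.le_succ m))
      rw [e]
      refine (norm_add_le _ _).trans ?_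
      rw [norm_mul, Complex.norm_real, Real.norm_of_nonneg hd]
      have := mul_le_mul_of_nonneg_left (h (m + 1) (by omega)) hd
      linarith [ih (by omega)]
  rcases Nat.eq_zero_or_pos N with h0 | h0
  · subst h0; simpa using mul_nonneg (hw0 0) hB
  obtain ⟨m, rfl⟩ : ∃ m, N = m + 1 := ⟨N - 1, by omega⟩
  have h1 := key m (by omega)
  have h2 : ‖(w m : ℂ) * ∑ n ∈ range (m + 1), z n‖ ≤ w m * B := by
    rw [norm_mul, Complex.norm_real, Real.norm_of_nonneg (hw0 m)]
    exact mul_le_mul_of_nonneg_left (h _ le_rfl) (hw0 m)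
  have h3 := norm_add_le (∑ n ∈ range (m + 1), w n * z n - w m * ∑ n ∈ range (m + 1), z n)
    (w m * ∑ n ∈ range (m + 1), z n)
  rw [sub_add_cancel] at h3
  linarith

lemma ofReal_cpow_neg_eq {y : ℝ} (hy : 0 < y) (σ t : ℝ) :
    (y : ℂ) ^ (-(σ + t * Complex.I)) =
      (y ^ (-σ) : ℝ) * unitPhase (-(t / (2 * Real.pi) * Real.log y)) := by
  have hpi := Real.pi_ne_zero
  rw [Complex.cpow_def_of_ne_zero (by exact_mod_cast hy.ne'), ← Complex.ofReal_log hy.le,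
    Real.rpow_def_of_pos hy, Complex.ofReal_exp, unitPhase, ← Complex.exp_add]
  congr 1
  have e : 2 * Real.pi * -(t / (2 * Real.pi) * Real.log y) = -(t * Real.log y) := by field_simp
  rw [e]
  push_cast
  ring

lemma norm_sum_unitPhase_abs_mul (s : Finset ℕ) (t : ℝ) (g : ℕ → ℝ) :
    ‖∑ n ∈ s, unitPhase (-(t / (2 * Real.pi) * g n))‖ =
      ‖∑ n ∈ s, unitPhase (|t| / (2 * Real.pi) * g n)‖ := by
  rcases abs_cases t with ⟨h, _⟩ | ⟨h, _⟩
  · rw [h, norm_sum_unitPhase_neg]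
  · simp only [h, neg_div, neg_mul]

lemma norm_sum_cpow_neg_le {X x σ t B : ℝ} {M : ℕ} (hX : 0 < X) (hXx : X ≤ x) (hσ : 0 ≤ σ)
    (h : ∀ M' ≤ M, ‖∑ m ∈ Finset.range M',
      unitPhase (|t| / (2 * Real.pi) * Real.log (x + m))‖ ≤ B) :
    ‖∑ m ∈ Finset.range M, ((x + m : ℝ) : ℂ) ^ (-(σ + t * Complex.I))‖ ≤ X ^ (-σ) * B := by
  have hx : 0 < x := by linarith
  have hB : 0 ≤ B := (norm_nonneg _).trans (h 0 (Nat.zero_le _))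
  have e : ∀ m : ℕ, ((x + m : ℝ) : ℂ) ^ (-(σ + t * Complex.I)) = ((x + m) ^ (-σ) : ℝ) *
      unitPhase (-(t / (2 * Real.pi) * Real.log (x + m))) := fun m =>
    ofReal_cpow_neg_eq (by positivity) σ t
  simp_rw [e]
  refine (norm_sum_antitone_mul_le (w := fun m : ℕ => (x + m) ^ (-σ)) (B := B)
    (fun m => by positivity) ?_ hB ?_).trans ?_
  · intro m n hmn
    have : (m : ℝ) ≤ n := by exact_mod_cast hmn
    exact Real.rpow_le_rpow_of_nonpos (by positivity) (by linarith) (by linarith)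
  · intro M' hM'
    rw [norm_sum_unitPhase_abs_mul]
    exact h M' hM'
  · refine mul_le_mul_of_nonneg_right ?_ hB
    simp only [Nat.cast_zero, add_zero]
    exact Real.rpow_le_rpow_of_nonpos hX hXx (by linarith)

lemma norm_sum_cpow_neg_block_le (j : ℕ) :
    ∃ A : ℝ, 0 ≤ A ∧ ∀ (σ t X x : ℝ) (M : ℕ), 1 / 2 ≤ σ →
      1 - (j + 2 : ℕ) / ((2 * (2 ^ (j + 1) - 1) : ℕ) : ℝ) ≤ σ → 2 ≤ |t| → 1 ≤ X → X ≤ |t| ^ 2 →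
      X ≤ x → x ≤ X + 1 → (M : ℝ) ≤ X →
      ‖∑ m ∈ Finset.range M, ((x + m : ℝ) : ℂ) ^ (-(σ + t * Complex.I))‖ ≤
        A * |t| ^ (1 / ((2 * (2 ^ (j + 1) - 1) : ℕ) : ℝ)) := by
  obtain ⟨A, hA, h⟩ := norm_sum_unitPhase_log_le_of_le j
  refine ⟨A + 8 * Real.pi, by positivity, fun σ t X x M hσ hσ' ht hX hXt hXx hxX hM => ?_⟩
  have hp1 : 1 ≤ 2 ^ (j + 1) - 1 := by
    have : 2 ≤ 2 ^ (j + 1) := by rw [pow_succ]; have := Nat.one_le_two_pow (n := j); omega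
    omega
  generalize hp : 2 ^ (j + 1) - 1 = p at *
  set τ := |t| with hτ
  have hτ0 : 0 < τ := by linarith
  have hX0 : 0 < X := by linarith
  have hq0 : (0 : ℝ) < (2 * p : ℕ) := by exact_mod_cast (by omega : 0 < 2 * p)
  set q : ℝ := ((2 * p : ℕ) : ℝ) with hq
  have hτq : 1 ≤ τ ^ (1 / q) := Real.one_le_rpow (by linarith) (by positivity)
  have hM' : ∀ M' ≤ M, (M' : ℝ) ≤ X := fun M' h => le_trans (by exact_mod_cast h) hM
  rcases le_total X τ with hc | hc
  · set μ : ℝ := (τ / X ^ (j + 2)) ^ (q⁻¹) with hμ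
    have hμ0 : 0 < μ := by positivity
    have hμp : μ ^ (2 * p) = τ / X ^ (j + 2) :=
      Real.rpow_inv_natCast_pow (by positivity) (by omega)
    have h1 := norm_sum_cpow_neg_le (σ := σ) (t := t) hX0 hXx (by linarith) fun M' hM'' =>
      h τ X x μ M' hX hc hXx hxX (hM' M' hM'') hμ0 (by rw [hμp]; field_simp)
    refine h1.trans ?_
    have h2 : X ^ (-σ) * X ≤ X ^ ((j + 2 : ℕ) * q⁻¹ : ℝ) := by
      calc X ^ (-σ) * X = X ^ (-σ + 1) := by rw [Real.rpow_add hX0, Real.rpow_one]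
        _ ≤ _ := by
          refine Real.rpow_le_rpow_of_exponent_le hX ?_
          rw [← div_eq_mul_inv]
          linarith
    have h3 : X ^ ((j + 2 : ℕ) * q⁻¹ : ℝ) * μ = τ ^ (1 / q) := by
      rw [Real.rpow_mul hX0.le, Real.rpow_natCast, hμ, ← Real.mul_rpow (by positivity) (by positivity),
        mul_div_cancel₀ _ (by positivity), one_div]
    calc X ^ (-σ) * (A * (X * μ)) = A * ((X ^ (-σ) * X) * μ) := by ring
      _ ≤ A * (X ^ ((j + 2 : ℕ) * q⁻¹ : ℝ) * μ) := by gcongr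
      _ = A * τ ^ (1 / q) := by rw [h3]
      _ ≤ _ := by
        gcongr
        linarith [Real.pi_pos]
  · have h1 := norm_sum_cpow_neg_le (σ := σ) (t := t) hX0 hXx (by linarith) fun M' hM'' =>
      norm_sum_unitPhase_log_le_of_ge hτ0 hX hc hXx hxX (hM' M' hM'')
    refine h1.trans ?_
    have h2 : X ^ (-σ) * X ≤ τ := by
      calc X ^ (-σ) * X = X ^ (-σ + 1) := by rw [Real.rpow_add hX0, Real.rpow_one]
        _ ≤ X ^ (1 / 2 : ℝ) := Real.rpow_le_rpow_of_exponent_le hX (by linarith)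
        _ ≤ (τ ^ 2) ^ (1 / 2 : ℝ) := by gcongr
        _ = τ := by rw [← Real.sqrt_eq_rpow, Real.sqrt_sq hτ0.le]
    calc X ^ (-σ) * (8 * Real.pi * (X / τ)) = 8 * Real.pi * ((X ^ (-σ) * X) / τ) := by ring
      _ ≤ 8 * Real.pi * 1 := by
        gcongr
        exact (div_le_one hτ0).mpr h2
      _ ≤ (A + 8 * Real.pi) * τ ^ (1 / q) := by
        have := Real.pi_pos
        nlinarith

open Finset in
lemma norm_sum_range_two_pow_le {g : ℕ → ℂ} {B : ℝ} (J : ℕ)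
    (h : ∀ i < J, ‖∑ m ∈ range (2 ^ i), g (2 ^ i + m)‖ ≤ B) :
    ‖∑ n ∈ range (2 ^ J), g n‖ ≤ ‖g 0‖ + J * B := by
  induction J with
  | zero => simp
  | succ J ih =>
    rw [pow_succ, mul_two, sum_range_add]
    refine (norm_add_le _ _).trans ?_
    push_cast
    linarith [ih fun i hi => h i (by omega), h J (by omega)]

lemma exists_two_pow_mem {y : ℝ} (hy : 1 ≤ y) :
    ∃ J : ℕ, y ≤ 2 ^ J ∧ (2 : ℝ) ^ J ≤ 2 * y ∧ (∀ i < J, (2 : ℝ) ^ i ≤ y) ∧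
      J * Real.log 2 ≤ Real.log y + Real.log 2 := by
  obtain ⟨J, h1, h2⟩ := exists_nat_pow_near hy one_lt_two
  refine ⟨J + 1, h2.le, ?_, fun i hi => ?_, ?_⟩
  · rw [pow_succ]; linarith
  · exact le_trans (pow_le_pow_right₀ one_le_two (by omega)) h1
  · have := Real.log_le_log (by positivity) h1
    rw [Real.log_pow] at this
    push_cast
    linarith

/-! ### Approximation of the Hurwitz zeta function by partial sums -/

lemma norm_ofReal_cpow_neg_sub_le {x y : ℝ} {s : ℂ} (hx : 0 < x) (hxy : x ≤ y) (hs : 0 < s.re) :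
    ‖(y : ℂ) ^ (-s) - (x : ℂ) ^ (-s)‖ ≤ ‖s‖ * x ^ (-s.re - 1) * (y - x) := by
  have hs0 : s ≠ 0 := by rintro rfl; simp at hs
  have h := (convex_Ici x).norm_image_sub_le_of_norm_hasDerivWithin_le
    (f := fun y : ℝ => (y : ℂ) ^ (-s - 1 + 1) / (-s - 1 + 1)) (f' := fun y => (y : ℂ) ^ (-s - 1))
    (C := x ^ (-s.re - 1)) (x := x) (y := y)
    (fun v hv => (hasDerivAt_ofReal_cpow_const' (hx.trans_le hv).ne' (by
      intro h; apply hs0; linear_combination -h)).hasDerivWithinAt)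
    (fun v hv => by
      rw [Complex.norm_cpow_eq_rpow_re_of_pos (hx.trans_le hv)]
      simp only [Complex.sub_re, Complex.neg_re, Complex.one_re]
      exact Real.rpow_le_rpow_of_nonpos hx hv (by linarith))
    Set.self_mem_Ici hxy
  rw [Real.norm_of_nonneg (by linarith)] at h
  have e : (y : ℂ) ^ (-s) - (x : ℂ) ^ (-s) =
      -s * ((y : ℂ) ^ (-s - 1 + 1) / (-s - 1 + 1) - (x : ℂ) ^ (-s - 1 + 1) / (-s - 1 + 1)) := by
    rw [sub_add_cancel]
    field_simp
    ring
  rw [e, norm_mul, norm_neg, mul_assoc]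
  exact mul_le_mul_of_nonneg_left h (norm_nonneg s)

/-- The difference between `x ^ (-s)` and the integral of `y ^ (-s)` over `[x, x + 1]`. -/
noncomputable def cpowDefect (x : ℝ) (s : ℂ) : ℂ :=
  (x : ℂ) ^ (-s) - (((x + 1 : ℝ) : ℂ) ^ (1 - s) - (x : ℂ) ^ (1 - s)) / (1 - s)

lemma norm_cpowDefect_le {x : ℝ} {s : ℂ} (hx : 0 < x) (hs : 0 < s.re) (hs1 : s ≠ 1) :
    ‖cpowDefect x s‖ ≤ ‖s‖ * x ^ (-s.re - 1) := by
  have h := (convex_Icc x (x + 1)).norm_image_sub_le_of_norm_hasDerivWithin_le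
    (f := fun y : ℝ => (y : ℂ) ^ (-s + 1) / (-s + 1) - y * (x : ℂ) ^ (-s))
    (f' := fun y => (y : ℂ) ^ (-s) - 1 * (x : ℂ) ^ (-s))
    (C := ‖s‖ * x ^ (-s.re - 1)) (x := x) (y := x + 1)
    (fun v hv => ((hasDerivAt_ofReal_cpow_const' (hx.trans_le hv.1).ne' (by
      intro h; apply hs1; linear_combination -h)).sub
        ((Complex.ofRealCLM.hasDerivAt (x := v)).mul_const _)).hasDerivWithinAt)
    (fun v hv => by
      rw [one_mul]
      refine (norm_ofReal_cpow_neg_sub_le hx hv.1 hs).trans (mul_le_of_le_one_right (by positivity) ?_)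
      linarith [hv.2])
    ⟨le_rfl, by linarith⟩ ⟨by linarith, le_rfl⟩
  have e : cpowDefect x s = -(((x + 1 : ℝ) : ℂ) ^ (-s + 1) / (-s + 1) - (x + 1 : ℝ) * (x : ℂ) ^ (-s) -
      ((x : ℂ) ^ (-s + 1) / (-s + 1) - x * (x : ℂ) ^ (-s))) := by
    rw [cpowDefect, neg_add_eq_sub]
    push_cast
    ring
  rw [e, norm_neg]
  simpa using h

lemma differentiableAt_cpowDefect {x : ℝ} {s : ℂ} (hx : 0 < x) (hs1 : s ≠ 1) :
    DifferentiableAt ℂ (cpowDefect x) s := by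
  have h1 : (x : ℂ) ≠ 0 := by exact_mod_cast hx.ne'
  have h2 : ((x + 1 : ℝ) : ℂ) ≠ 0 := by exact_mod_cast (by positivity : x + 1 ≠ 0)
  have h3 : 1 - s ≠ 0 := sub_ne_zero.mpr hs1.symm
  unfold cpowDefect
  refine DifferentiableAt.sub ?_ (DifferentiableAt.div (DifferentiableAt.sub ?_ ?_) (by fun_prop) h3)
  · exact DifferentiableAt.const_cpow (by fun_prop) (Or.inl h1)
  · exact DifferentiableAt.const_cpow (by fun_prop) (Or.inl h2)
  · exact DifferentiableAt.const_cpow (by fun_prop) (Or.inl h1)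

lemma rpow_neg_sub_one_le {x σ : ℝ} (hx : 1 < x) (hσ : 0 < σ) :
    x ^ (-σ - 1) ≤ ((x - 1) ^ (-σ) - x ^ (-σ)) / σ := by
  obtain ⟨ξ, hξ, h⟩ := exists_hasDerivAt_eq_slope (fun y : ℝ => y ^ (-σ)) (fun y => -σ * y ^ (-σ - 1))
    (a := x - 1) (b := x) (by linarith)
    (fun y hy => (Real.continuousAt_rpow_const _ _ (Or.inl (by linarith [hy.1]))).continuousWithinAt)
    (fun y hy => Real.hasDerivAt_rpow_const (Or.inl (by linarith [hy.1])))
  rw [sub_sub_cancel, div_one] at h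
  rw [le_div_iff₀ hσ]
  have h2 : x ^ (-σ - 1) ≤ ξ ^ (-σ - 1) :=
    Real.rpow_le_rpow_of_nonpos (by linarith [hξ.1]) hξ.2.le (by linarith)
  nlinarith

lemma sum_range_rpow_neg_sub_one_le {β σ : ℝ} (hβ : 1 < β) (hσ : 0 < σ) (N : ℕ) :
    ∑ n ∈ Finset.range N, (β + n) ^ (-σ - 1) ≤ (β - 1) ^ (-σ) / σ := by
  have key : ∑ n ∈ Finset.range N, (β + n) ^ (-σ - 1) ≤
      ((β - 1) ^ (-σ) - (β + N - 1) ^ (-σ)) / σ := by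
    induction N with
    | zero => simp
    | succ N ih =>
      rw [Finset.sum_range_succ]
      have := rpow_neg_sub_one_le (x := β + N) (by linarith [Nat.cast_nonneg (α := ℝ) N]) hσ
      push_cast
      rw [show β + ((N : ℝ) + 1) - 1 = β + N by ring]
      refine (add_le_add ih this).trans (le_of_eq ?_)
      ring
  refine key.trans ?_
  have h0 : 0 ≤ β + N - 1 := by linarith [Nat.cast_nonneg (α := ℝ) N]
  gcongr
  linarith [Real.rpow_nonneg h0 (-σ)]

lemma summable_rpow_neg_sub_one {β σ : ℝ} (hβ : 1 < β) (hσ : 0 < σ) :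
    Summable fun n : ℕ => (β + n) ^ (-σ - 1) :=
  summable_of_sum_range_le (fun n => by positivity) (sum_range_rpow_neg_sub_one_le hβ hσ)

lemma norm_tsum_cpowDefect_le {β : ℝ} {s : ℂ} (hβ : 1 < β) (hs : 0 < s.re) (hs1 : s ≠ 1) :
    ‖∑' n : ℕ, cpowDefect (β + n) s‖ ≤ ‖s‖ * ((β - 1) ^ (-s.re) / s.re) := by
  refine (tsum_of_norm_bounded ((summable_rpow_neg_sub_one hβ hs).mul_left ‖s‖).hasSum
    fun n => norm_cpowDefect_le (by positivity) hs hs1).trans ?_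
  rw [tsum_mul_left]
  refine mul_le_mul_of_nonneg_left ?_ (norm_nonneg s)
  exact Real.tsum_le_of_sum_range_le (fun n => by positivity) (sum_range_rpow_neg_sub_one_le hβ hs)

lemma hasSum_cpowDefect {β : ℝ} {s : ℂ} {Z : ℂ} (hβ : 1 < β) (hs : 1 < s.re)
    (hZ : HasSum (fun n : ℕ => ((β + n : ℝ) : ℂ) ^ (-s)) Z) :
    ∑' n : ℕ, cpowDefect (β + n) s = Z - (β : ℂ) ^ (1 - s) / (s - 1) := by
  have hs1 : s ≠ 1 := by rintro rfl; simp at hs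
  have hsum : Summable fun n : ℕ => cpowDefect (β + n) s :=
    Summable.of_norm_bounded ((summable_rpow_neg_sub_one hβ (by linarith)).mul_left ‖s‖)
      fun n => norm_cpowDefect_le (by positivity) (by linarith) hs1
  refine tendsto_nhds_unique hsum.hasSum.tendsto_sum_nat ?_
  have e : ∀ N : ℕ, ∑ n ∈ Finset.range N, cpowDefect (β + n) s =
      ∑ n ∈ Finset.range N, ((β + n : ℝ) : ℂ) ^ (-s) -
        (((β + N : ℝ) : ℂ) ^ (1 - s) - (β : ℂ) ^ (1 - s)) / (1 - s) := by
    intro N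
    induction N with
    | zero => simp
    | succ N ih =>
      rw [Finset.sum_range_succ, Finset.sum_range_succ, ih, cpowDefect]
      rw [show β + ((N + 1 : ℕ) : ℝ) = β + N + 1 by push_cast; ring]
      ring
  simp_rw [e]
  have ht : Filter.Tendsto (fun N : ℕ => ((β + N : ℝ) : ℂ) ^ (1 - s)) Filter.atTop (nhds 0) := by
    rw [tendsto_zero_iff_norm_tendsto_zero]
    have e2 : ∀ N : ℕ, ‖((β + N : ℝ) : ℂ) ^ (1 - s)‖ = (β + N) ^ (-(s.re - 1)) := fun N => by
      rw [Complex.norm_cpow_eq_rpow_re_of_pos (by positivity)]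
      simp
    simp_rw [e2]
    exact (tendsto_rpow_neg_atTop (by linarith)).comp
      (Filter.tendsto_atTop_add_const_left _ β tendsto_natCast_atTop_atTop)
  have h3 := hZ.tendsto_sum_nat.sub ((ht.sub_const ((β : ℂ) ^ (1 - s))).div_const (1 - s))
  convert h3 using 2
  rw [← neg_sub 1 s, div_neg]
  ring

lemma hurwitzZeta_eq_of_one_lt_re {α : ℝ} (hα : 0 < α) (hα1 : α ≤ 1) {N : ℕ} (hN : 1 ≤ N) {s : ℂ}
    (hs : 1 < s.re) :
    HurwitzZeta.hurwitzZeta α s = ∑ n ∈ Finset.range N, ((α + n : ℝ) : ℂ) ^ (-s) +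
      ((α + N : ℝ) : ℂ) ^ (1 - s) / (s - 1) + ∑' n : ℕ, cpowDefect (α + N + n) s := by
  have hN' : (1 : ℝ) ≤ N := by exact_mod_cast hN
  have h := HurwitzZeta.hasSum_hurwitzZeta_of_one_lt_re (a := α) ⟨hα.le, hα1⟩ hs
  have e : (fun n : ℕ => 1 / ((n : ℂ) + α) ^ s) = fun n : ℕ => ((α + n : ℝ) : ℂ) ^ (-s) := by
    ext n
    rw [Complex.cpow_neg, one_div, add_comm]
    push_cast
    rfl
  rw [e, ← hasSum_nat_add_iff' N] at h
  have h2 := hasSum_cpowDefect (β := α + N) (by linarith) hs (Z := _) (by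
    rwa [show (fun n : ℕ => ((α + N + n : ℝ) : ℂ) ^ (-s)) =
      fun n : ℕ => ((α + (n + N : ℕ) : ℝ) : ℂ) ^ (-s) from
        funext fun n => by rw [show α + N + (n : ℝ) = α + ((n + N : ℕ) : ℝ) by push_cast; ring]])
  rw [h2]
  ring

lemma hurwitzZeta_eq {α : ℝ} (hα : 0 < α) (hα1 : α ≤ 1) {N : ℕ} (hN : 1 ≤ N) {s : ℂ}
    (hs : 0 < s.re) (hs' : s.im ≠ 0) :
    HurwitzZeta.hurwitzZeta α s = ∑ n ∈ Finset.range N, ((α + n : ℝ) : ℂ) ^ (-s) +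
      ((α + N : ℝ) : ℂ) ^ (1 - s) / (s - 1) + ∑' n : ℕ, cpowDefect (α + N + n) s := by
  have hN' : (1 : ℝ) ≤ N := by exact_mod_cast hN
  set δ := s.re / 2 with hδ
  set R := ‖s‖ + 3 with hR
  set V : Set ℂ := {z | δ < z.re} ∩ Metric.ball 0 R ∩ {z | 0 < s.im * z.im} with hV
  have hVo : IsOpen V := ((isOpen_lt continuous_const Complex.continuous_re).inter
    Metric.isOpen_ball).inter (isOpen_lt continuous_const (by fun_prop))
  have hVc : Convex ℝ V := by
    refine ((convex_halfSpace_re_gt δ).inter (convex_ball 0 R)).inter ?_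
    exact convex_halfSpace_gt (f := fun z : ℂ => s.im * z.im)
      ⟨fun x y => by simp [mul_add], fun c x => by simp; ring⟩ 0
  have hV1 : ∀ z ∈ V, z ≠ 1 := by
    rintro z ⟨_, hz⟩ rfl
    simp at hz
  have him : 0 < s.im * s.im := mul_self_pos.mpr hs'
  have hsV : s ∈ V := ⟨⟨by simp [hδ]; linarith, by simp [hR]⟩, him⟩
  have hs2V : s + 2 ∈ V := by
    refine ⟨⟨by simp [hδ]; linarith, ?_⟩, by simpa using him⟩
    rw [mem_ball_zero_iff]
    refine (norm_add_le _ _).trans_lt ?_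
    norm_num [hR]
  have hdiff : DifferentiableOn ℂ (fun z => ∑' n : ℕ, cpowDefect (α + N + n) z) V := by
    refine Complex.differentiableOn_tsum_of_summable_norm (u := fun n : ℕ => R * (α + N + n) ^ (-δ - 1))
      ((summable_rpow_neg_sub_one (by linarith) (by simp [hδ, hs])).mul_left R)
      (fun n z hz => (differentiableAt_cpowDefect (by positivity)
        (hV1 z hz)).differentiableWithinAt) hVo fun n z hz => ?_
    have hzδ : δ < z.re := hz.1.1
    have hδ0 : 0 < δ := by simp [hδ, hs]
    refine (norm_cpowDefect_le (by positivity) (by linarith) (hV1 z hz)).trans ?_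
    have h1 : ‖z‖ ≤ R := (mem_ball_zero_iff.mp hz.1.2).le
    have h2 : (α + N + n) ^ (-z.re - 1) ≤ (α + N + n) ^ (-δ - 1) :=
      Real.rpow_le_rpow_of_exponent_le (by linarith [Nat.cast_nonneg (α := ℝ) n]) (by linarith)
    gcongr
  have hf : AnalyticOnNhd ℂ (HurwitzZeta.hurwitzZeta α) V :=
    DifferentiableOn.analyticOnNhd (fun z hz =>
      (HurwitzZeta.differentiableAt_hurwitzZeta α (hV1 z hz)).differentiableWithinAt) hVo
  have hg : AnalyticOnNhd ℂ (fun s => ∑ n ∈ Finset.range N, ((α + n : ℝ) : ℂ) ^ (-s) +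
      ((α + N : ℝ) : ℂ) ^ (1 - s) / (s - 1) + ∑' n : ℕ, cpowDefect (α + N + n) s) V := by
    refine DifferentiableOn.analyticOnNhd (DifferentiableOn.add (fun z hz => ?_) hdiff) hVo
    have hne : ∀ n : ℕ, ((α + n : ℝ) : ℂ) ≠ 0 := fun n => by
      exact_mod_cast (by positivity : α + n ≠ 0)
    refine DifferentiableAt.differentiableWithinAt (DifferentiableAt.add ?_ ?_)
    · refine DifferentiableAt.fun_sum fun n _ => ?_
      exact DifferentiableAt.const_cpow (by fun_prop) (Or.inl (hne n))
    · refine DifferentiableAt.div ?_ (by fun_prop) (sub_ne_zero.mpr (hV1 z hz))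
      exact DifferentiableAt.const_cpow (by fun_prop) (Or.inl (hne N))
  refine hf.eqOn_of_preconnected_of_eventuallyEq hg hVc.isPreconnected hs2V ?_ hsV
  have : ∀ᶠ z in nhds (s + 2), 1 < z.re :=
    (isOpen_lt continuous_const Complex.continuous_re).mem_nhds (by simp; linarith)
  filter_upwards [this] with z hz
  exact hurwitzZeta_eq_of_one_lt_re hα hα1 hN hz

lemma norm_hurwitzZeta_sub_sum_le {α : ℝ} (hα : 0 < α) (hα1 : α ≤ 1) {N : ℕ} (hN : 1 ≤ N) {s : ℂ}
    (hs : 0 < s.re) (hs' : s.im ≠ 0) :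
    ‖HurwitzZeta.hurwitzZeta α s - ∑ n ∈ Finset.range N, ((α + n : ℝ) : ℂ) ^ (-s)‖ ≤
      (α + N) ^ (1 - s.re) / ‖s - 1‖ + ‖s‖ * ((α + N - 1) ^ (-s.re) / s.re) := by
  have hN' : (1 : ℝ) ≤ N := by exact_mod_cast hN
  have hs1 : s ≠ 1 := by rintro rfl; simp at hs'
  rw [hurwitzZeta_eq hα hα1 hN hs hs', add_assoc, add_sub_cancel_left]
  refine (norm_add_le _ _).trans (add_le_add ?_ (norm_tsum_cpowDefect_le (by linarith) hs hs1))
  rw [norm_div, Complex.norm_cpow_eq_rpow_re_of_pos (by positivity)]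
  simp

/-! ### Bounds for the Hurwitz zeta function and Dirichlet L-functions -/

lemma norm_hurwitzZeta_sub_sum_le_ten {α : ℝ} (hα : 0 < α) (hα1 : α ≤ 1) {σ t : ℝ}
    (hσ : 1 / 2 ≤ σ) (hσ2 : σ ≤ 2) (ht : 2 ≤ |t|) {N : ℕ} (hN : |t| ^ 2 ≤ N)
    (hN2 : (N : ℝ) ≤ 2 * |t| ^ 2) :
    ‖HurwitzZeta.hurwitzZeta α (σ + t * Complex.I) -
      ∑ n ∈ Finset.range N, ((α + n : ℝ) : ℂ) ^ (-(σ + t * Complex.I : ℂ))‖ ≤ 10 := by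
  have hN1 : (1 : ℝ) ≤ N := by nlinarith
  have ht0 : t ≠ 0 := by rintro rfl; norm_num at ht
  have hre : (σ + t * Complex.I : ℂ).re = σ := by simp
  have him : (σ + t * Complex.I : ℂ).im = t := by simp
  have h := norm_hurwitzZeta_sub_sum_le hα hα1 (N := N) (by exact_mod_cast hN1)
    (s := σ + t * Complex.I) (by rw [hre]; linarith) (by rwa [him])
  rw [hre] at h
  refine h.trans ?_
  have h1 : |t| ≤ ‖(σ + t * Complex.I : ℂ) - 1‖ := by
    simpa using Complex.abs_im_le_norm ((σ + t * Complex.I : ℂ) - 1)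
  have h2 : (α + N) ^ (1 - σ) ≤ 2 * |t| := by
    calc (α + N) ^ (1 - σ) ≤ (α + N) ^ (1 / 2 : ℝ) :=
          Real.rpow_le_rpow_of_exponent_le (by linarith) (by linarith)
      _ ≤ ((2 * |t|) ^ 2) ^ (1 / 2 : ℝ) := by
          refine Real.rpow_le_rpow (by positivity) ?_ (by norm_num)
          nlinarith
      _ = 2 * |t| := by
          rw [← Real.sqrt_eq_rpow, Real.sqrt_sq (by positivity)]
  have h3 : ‖(σ + t * Complex.I : ℂ)‖ ≤ 2 * |t| := by
    refine (norm_add_le _ _).trans ?_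
    rw [norm_mul, Complex.norm_I, Complex.norm_real, Complex.norm_real, Real.norm_eq_abs,
      Real.norm_eq_abs, abs_of_nonneg (by linarith : 0 ≤ σ)]
    linarith
  have h4 : (α + N - 1) ^ (-σ) ≤ 2 / |t| := by
    have hb : (|t| / 2) ^ 2 ≤ α + N - 1 := by nlinarith
    calc (α + N - 1) ^ (-σ) ≤ (α + N - 1) ^ (-(1 / 2) : ℝ) :=
          Real.rpow_le_rpow_of_exponent_le (by nlinarith) (by linarith)
      _ ≤ ((|t| / 2) ^ 2) ^ (-(1 / 2) : ℝ) :=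
          Real.rpow_le_rpow_of_nonpos (by positivity) hb (by norm_num)
      _ = 2 / |t| := by
          rw [Real.rpow_neg (by positivity), ← Real.sqrt_eq_rpow, Real.sqrt_sq (by positivity),
            inv_div]
  have h5 : (α + N) ^ (1 - σ) / ‖(σ + t * Complex.I : ℂ) - 1‖ ≤ 2 := by
    rw [div_le_iff₀ (by linarith)]
    linarith
  have h6 : (α + N - 1) ^ (-σ) / σ ≤ 4 / |t| := by
    rw [div_le_iff₀ (by linarith)]
    refine h4.trans ?_
    rw [div_mul_eq_mul_div]
    gcongr
    linarith
  have h7 : ‖(σ + t * Complex.I : ℂ)‖ * ((α + N - 1) ^ (-σ) / σ) ≤ 8 := by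
    calc _ ≤ 2 * |t| * (4 / |t|) := by
          refine mul_le_mul h3 h6 (div_nonneg (Real.rpow_nonneg (by linarith) _) (by linarith))
            (by positivity)
      _ = 8 := by
          field_simp
          norm_num
  linarith

lemma const_le_mul_rpow_mul_log {K T e : ℝ} (hK : 0 ≤ K) (hT : 2 ≤ T) (he : 0 ≤ e) :
    K ≤ K / Real.log 2 * T ^ e * Real.log T := by
  have hl2 : 0 < Real.log 2 := Real.log_pos (by norm_num)
  have h1 : 1 ≤ T ^ e := Real.one_le_rpow (by linarith) he
  have h2 : Real.log 2 ≤ Real.log T := Real.log_le_log (by norm_num) hT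
  calc K = K / Real.log 2 * 1 * Real.log 2 := by field_simp
    _ ≤ _ := by gcongr

lemma exists_norm_hurwitzZeta_le {α : ℝ} (hα : 0 < α) (hα1 : α ≤ 1) (j : ℕ) :
    ∃ C : ℝ, 0 ≤ C ∧ ∀ σ t : ℝ, 1 / 2 ≤ σ → σ ≤ 2 →
      1 - (j + 2 : ℕ) / ((2 * (2 ^ (j + 1) - 1) : ℕ) : ℝ) ≤ σ → 2 ≤ |t| →
      ‖HurwitzZeta.hurwitzZeta α (σ + t * Complex.I)‖ ≤
        C * |t| ^ (1 / ((2 * (2 ^ (j + 1) - 1) : ℕ) : ℝ)) * Real.log |t| := by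
  obtain ⟨A, hA, hblock⟩ := norm_sum_cpow_neg_block_le j
  have hl2 : 0 < Real.log 2 := Real.log_pos (by norm_num)
  refine ⟨(α ^ (-2 : ℝ) + 10) / Real.log 2 + 3 * A / Real.log 2, by positivity, ?_⟩
  intro σ t hσ hσ2 hσj ht
  set e : ℝ := 1 / ((2 * (2 ^ (j + 1) - 1) : ℕ) : ℝ) with he
  have he0 : 0 ≤ e := by positivity
  have hlog : Real.log 2 ≤ Real.log |t| := Real.log_le_log (by norm_num) ht
  obtain ⟨J, hJ1, hJ2, hJ3, hJ4⟩ := exists_two_pow_mem (y := |t| ^ 2) (by nlinarith)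
  have hsum := norm_sum_range_two_pow_le
    (g := fun n : ℕ => ((α + n : ℝ) : ℂ) ^ (-(σ + t * Complex.I : ℂ))) (B := A * |t| ^ e) J (by
      intro i hi
      have h := hblock σ t (2 ^ i) (2 ^ i + α) (2 ^ i) hσ hσj ht (one_le_pow₀ (by norm_num))
        (hJ3 i hi) (by linarith) (by linarith) (by simp)
      convert h using 5 with m
      push_cast
      ring)
  have happrox := norm_hurwitzZeta_sub_sum_le_ten hα hα1 hσ hσ2 ht (N := 2 ^ J)
    (by exact_mod_cast hJ1) (by exact_mod_cast hJ2)
  have hg0 : ‖((α + (0 : ℕ) : ℝ) : ℂ) ^ (-(σ + t * Complex.I : ℂ))‖ ≤ α ^ (-2 : ℝ) := by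
    rw [Nat.cast_zero, add_zero, Complex.norm_cpow_eq_rpow_re_of_pos hα]
    exact Real.rpow_le_rpow_of_exponent_ge hα hα1 (by simp [hσ2])
  have hJ : J * (A * |t| ^ e) ≤ 3 * A / Real.log 2 * |t| ^ e * Real.log |t| := by
    have : (J : ℝ) ≤ 3 * Real.log |t| / Real.log 2 := by
      rw [le_div_iff₀ hl2]
      rw [Real.log_pow] at hJ4
      push_cast at hJ4
      linarith
    calc J * (A * |t| ^ e) ≤ 3 * Real.log |t| / Real.log 2 * (A * |t| ^ e) := by gcongr
      _ = _ := by ring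
  have hK := const_le_mul_rpow_mul_log (K := α ^ (-2 : ℝ) + 10) (by positivity) ht he0
  have htri := norm_sub_norm_le (HurwitzZeta.hurwitzZeta α (σ + t * Complex.I))
    (∑ n ∈ Finset.range (2 ^ J), ((α + n : ℝ) : ℂ) ^ (-(σ + t * Complex.I : ℂ)))
  rw [add_mul, add_mul]
  linarith

lemma exists_norm_hurwitzZeta_toAddCircle_le {a : ℕ} [NeZero a] (k : ZMod a) (j : ℕ) :
    ∃ C : ℝ, 0 ≤ C ∧ ∀ σ t : ℝ, 1 / 2 ≤ σ → σ ≤ 2 →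
      1 - (j + 2 : ℕ) / ((2 * (2 ^ (j + 1) - 1) : ℕ) : ℝ) ≤ σ → 2 ≤ |t| →
      ‖HurwitzZeta.hurwitzZeta (ZMod.toAddCircle k) (σ + t * Complex.I)‖ ≤
        C * |t| ^ (1 / ((2 * (2 ^ (j + 1) - 1) : ℕ) : ℝ)) * Real.log |t| := by
  have ha : (0 : ℝ) < a := by exact_mod_cast NeZero.pos a
  by_cases hk : k = 0
  · have h : ZMod.toAddCircle k = ((1 : ℝ) : UnitAddCircle) := by
      rw [hk, map_zero]
      exact (AddCircle.coe_period 1).symm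
    rw [h]
    exact exists_norm_hurwitzZeta_le one_pos le_rfl j
  · rw [ZMod.toAddCircle_apply]
    refine exists_norm_hurwitzZeta_le (div_pos ?_ ha) ?_ j
    · exact_mod_cast Nat.pos_of_ne_zero ((ZMod.val_ne_zero k).mpr hk)
    · rw [div_le_one ha]
      exact_mod_cast (ZMod.val_lt k).le

lemma exists_norm_LFunction_le (a : ℕ) [NeZero a] (j : ℕ) :
    ∃ C : ℝ, 0 ≤ C ∧ ∀ (χ : DirichletCharacter ℂ a) (σ t : ℝ), 1 / 2 ≤ σ → σ ≤ 2 →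
      1 - (j + 2 : ℕ) / ((2 * (2 ^ (j + 1) - 1) : ℕ) : ℝ) ≤ σ → 2 ≤ |t| →
      ‖DirichletCharacter.LFunction χ (σ + t * Complex.I)‖ ≤
        C * |t| ^ (1 / ((2 * (2 ^ (j + 1) - 1) : ℕ) : ℝ)) * Real.log |t| := by
  choose C hC hbound using fun k : ZMod a => exists_norm_hurwitzZeta_toAddCircle_le k j
  refine ⟨∑ k, C k, Finset.sum_nonneg fun k _ => hC k, fun χ σ t hσ hσ2 hσj ht => ?_⟩
  have ha : (1 : ℝ) ≤ a := by exact_mod_cast NeZero.one_le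
  rw [DirichletCharacter.LFunction, ZMod.LFunction, norm_mul]
  have h1 : ‖(a : ℂ) ^ (-(σ + t * Complex.I : ℂ))‖ ≤ 1 := by
    rw [Complex.norm_natCast_cpow_of_pos (NeZero.pos a)]
    exact Real.rpow_le_one_of_one_le_of_nonpos ha (by simp; linarith)
  refine (mul_le_of_le_one_left (norm_nonneg _) h1).trans ?_
  rw [Finset.sum_mul, Finset.sum_mul]
  refine norm_sum_le_of_le _ fun k _ => ?_
  rw [norm_mul]
  exact (mul_le_of_le_one_left (norm_nonneg _) (χ.norm_le_one k)).trans
    (hbound k σ t hσ hσ2 hσj ht)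

lemma norm_LFunction_le_of_two_le_re {a : ℕ} [NeZero a] (χ : DirichletCharacter ℂ a) {s : ℂ}
    (hs : 2 ≤ s.re) :
    ‖DirichletCharacter.LFunction χ s‖ ≤ ∑' n : ℕ, 1 / (n : ℝ) ^ 2 := by
  rw [DirichletCharacter.LFunction_eq_LSeries χ (by linarith), LSeries]
  refine tsum_of_norm_bounded (Real.summable_one_div_nat_pow.mpr one_lt_two).hasSum fun n => ?_
  rcases Nat.eq_zero_or_pos n with rfl | hn
  · simp
  · rw [LSeries.norm_term_eq, if_neg hn.ne', ← Real.rpow_two]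
    have hn1 : (1 : ℝ) ≤ n := by exact_mod_cast hn
    gcongr
    · exact χ.norm_le_one _

lemma two_mul_le_two_pow_sub_two {l : ℕ} (hl : 3 ≤ l) : 2 * (l : ℝ) ≤ 2 * 2 ^ (l - 1) - 2 := by
  induction l, hl using Nat.le_induction with
  | base => norm_num
  | succ n hn ih =>
    obtain ⟨m, rfl⟩ : ∃ m, n = m + 1 := ⟨n - 1, by omega⟩
    simp only [Nat.add_sub_cancel] at ih ⊢
    push_cast at ih ⊢
    rw [pow_succ]
    have : (2 : ℝ) ≤ m := by exact_mod_cast (by omega : 2 ≤ m)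
    linarith

/-- Pan & Pan's subconvexity bound: for `l ≥ 3`, `L = 2^(l-1)` and
`σ_l = 1 - l/(2L-2)`, one has `L(σ + it, χ) ≪_a |t|^{1/(2L-2)} log |t|`
uniformly for `σ ≥ σ_l` and `|t| ≥ 2`. -/
theorem stmt8 (l : ℕ) (hl : 3 ≤ l) (a : ℕ) [NeZero a] :
    ∃ C : ℝ, ∀ (χ : DirichletCharacter ℂ a) (σ t : ℝ),
      1 - (l : ℝ) / (2 * 2 ^ (l - 1) - 2) ≤ σ → 2 ≤ |t| →
      ‖DirichletCharacter.LFunction χ (σ + t * Complex.I)‖ ≤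
        C * |t| ^ (1 / (2 * 2 ^ (l - 1) - 2 : ℝ)) * Real.log |t| := by
  have hl2 : 0 < Real.log 2 := Real.log_pos (by norm_num)
  have hpow := two_mul_le_two_pow_sub_two hl
  have hl3 : (3 : ℝ) ≤ l := by exact_mod_cast hl
  obtain ⟨j, rfl⟩ : ∃ j, l = j + 2 := ⟨l - 2, by omega⟩
  have hcast : ((2 * (2 ^ (j + 1) - 1) : ℕ) : ℝ) = 2 * 2 ^ (j + 2 - 1) - 2 := by
    rw [Nat.cast_mul, Nat.cast_sub Nat.one_le_two_pow]
    push_cast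
    ring
  obtain ⟨C, hC, hbound⟩ := exists_norm_LFunction_le a j
  rw [hcast] at hbound
  set q : ℝ := 2 * 2 ^ (j + 2 - 1) - 2 with hq
  set S : ℝ := ∑' n : ℕ, 1 / (n : ℝ) ^ 2
  have hS : 0 ≤ S := tsum_nonneg fun n => by positivity
  have he : 0 ≤ 1 / q := one_div_nonneg.mpr (by linarith)
  refine ⟨C + S / Real.log 2, fun χ σ t hσ ht => ?_⟩
  have hlog : 0 ≤ Real.log |t| := Real.log_nonneg (by linarith)
  have hS2 := const_le_mul_rpow_mul_log hS ht he
  rw [add_mul, add_mul]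
  rcases le_total σ 2 with h2 | h2
  · have hhalf : 1 / 2 ≤ σ := by
      have : ((j + 2 : ℕ) : ℝ) / q ≤ 1 / 2 := by
        rw [div_le_iff₀ (by linarith)]
        linarith
      linarith
    linarith [hbound χ σ t hhalf h2 hσ ht]
  · have hn := norm_LFunction_le_of_two_le_re χ (s := σ + t * Complex.I) (by simpa using h2)
    have : 0 ≤ C * |t| ^ (1 / q) * Real.log |t| := by positivity
    linarith
end

section
/- For positive integers a and n, the number R(n;a) of ordered pairs (x,y) of positive integers with a/n = 1/x + 1/y equals the number of ordered pairs (u,v) of positive integers with u·v = n², u ≡ −n (mod a), and v ≡ −n (mod a). -/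
/-- `R n a` is the number of ordered pairs `(x, y)` of positive integers
satisfying `a / n = 1 / x + 1 / y`. -/
noncomputable def R (n a : ℕ) : ℕ :=
  Nat.card {p : ℕ × ℕ | 0 < p.1 ∧ 0 < p.2 ∧ (a : ℚ) / n = 1 / p.1 + 1 / p.2}

theorem div_eq_one_div_add_one_div_iff {a n x y : ℕ} (hn : 0 < n) (hx : 0 < x) (hy : 0 < y) :
    (a : ℚ) / n = 1 / x + 1 / y ↔ a * x * y = n * (x + y) := by
  have hn' : (n : ℚ) ≠ 0 := by positivity
  have hx' : (x : ℚ) ≠ 0 := by positivity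
  have hy' : (y : ℚ) ≠ 0 := by positivity
  rw [div_add_div _ _ hx' hy', div_eq_div_iff hn' (mul_ne_zero hx' hy'), ← Nat.cast_inj (R := ℚ)]
  push_cast
  constructor <;> intro h <;> linarith

theorem lt_mul_of_mul_mul_eq {a n x y : ℕ} (hn : 0 < n) (hx : 0 < x)
    (h : a * x * y = n * (x + y)) : n < a * x := by
  refine lt_of_mul_lt_mul_right (a := y) ?_ (Nat.zero_le y)
  rw [h]
  nlinarith [Nat.mul_pos hn hx]

theorem natCast_zmod_eq_neg_iff_dvd_add {a n u : ℕ} :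
    (u : ZMod a) = -(n : ZMod a) ↔ a ∣ u + n := by
  rw [eq_neg_iff_add_eq_zero, ← Nat.cast_add, ZMod.natCast_eq_zero_iff]

theorem mul_mul_eq_iff_of_add_eq_mul {a n x y u v : ℕ} (ha : 0 < a)
    (hu : u + n = a * x) (hv : v + n = a * y) :
    a * x * y = n * (x + y) ↔ u * v = n ^ 2 := by
  rw [← Nat.mul_right_inj ha.ne']
  have h₁ : a * (a * x * y) = (u + n) * (v + n) := by rw [hu, hv]; ring
  have h₂ : a * (n * (x + y)) = n * ((u + n) + (v + n)) := by rw [hu, hv]; ring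
  rw [h₁, h₂]
  constructor <;> intro h <;> nlinarith

/-- `R(n; a)` equals the number of ordered pairs `(u, v)` of positive integers
with `u v = n²` and `u ≡ v ≡ -n (mod a)`. -/
theorem stmt10 (a n : ℕ) (ha : 0 < a) (hn : 0 < n) :
    R n a = Nat.card {p : ℕ × ℕ | 0 < p.1 ∧ 0 < p.2 ∧ p.1 * p.2 = n ^ 2 ∧
      (p.1 : ZMod a) = -(n : ZMod a) ∧ (p.2 : ZMod a) = -(n : ZMod a)} := by
  simp only [natCast_zmod_eq_neg_iff_dvd_add]
  refine Nat.card_congr (Set.BijOn.equiv (fun p => (a * p.1 - n, a * p.2 - n)) ⟨?_, ?_, ?_⟩)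
  · rintro ⟨x, y⟩ ⟨hx, hy, h⟩
    dsimp only at hx hy h
    rw [div_eq_one_div_add_one_div_iff hn hx hy] at h
    have h₁ := lt_mul_of_mul_mul_eq hn hx h
    have h₂ : n < a * y := lt_mul_of_mul_mul_eq (y := x) hn hy (by linarith)
    have hu := Nat.sub_add_cancel h₁.le
    have hv := Nat.sub_add_cancel h₂.le
    exact ⟨Nat.sub_pos_of_lt h₁, Nat.sub_pos_of_lt h₂,
      (mul_mul_eq_iff_of_add_eq_mul ha hu hv).1 h, ⟨x, hu⟩, ⟨y, hv⟩⟩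
  · rintro ⟨x, y⟩ ⟨hx, hy, h⟩ ⟨x', y'⟩ ⟨hx', hy', h'⟩ heq
    dsimp only at hx hy h hx' hy' h'
    rw [div_eq_one_div_add_one_div_iff hn hx hy] at h
    rw [div_eq_one_div_add_one_div_iff hn hx' hy'] at h'
    have h₁ := lt_mul_of_mul_mul_eq hn hx h
    have h₂ : n < a * y := lt_mul_of_mul_mul_eq (y := x) hn hy (by linarith)
    obtain ⟨e₁, e₂⟩ := Prod.mk.inj heq
    dsimp only at e₁ e₂
    exact Prod.ext (Nat.eq_of_mul_eq_mul_left ha (by dsimp only; omega))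
      (Nat.eq_of_mul_eq_mul_left ha (by dsimp only; omega))
  · rintro ⟨u, v⟩ ⟨-, -, h, ⟨x, hx⟩, ⟨y, hy⟩⟩
    dsimp only at h hx hy
    have hx₀ : 0 < x := Nat.pos_of_mul_pos_left (by omega : 0 < a * x)
    have hy₀ : 0 < y := Nat.pos_of_mul_pos_left (by omega : 0 < a * y)
    exact ⟨(x, y), ⟨hx₀, hy₀, (div_eq_one_div_add_one_div_iff hn hx₀ hy₀).2
      ((mul_mul_eq_iff_of_add_eq_mul ha hx hy).2 h)⟩, Prod.ext (by dsimp only; omega)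
        (by dsimp only; omega)⟩
end
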